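/- arXiv:1405.0235 — 6 statements merged into one kernel-verified Lean document; each statement's English description precedes it below -/
import Mathlib

section
/- Let μ be a centered Gaussian probability measure on a separable real Hilbert space H, let S : H → H be its covariance operator, i.e. the continuous linear operator satisfying ⟨S x, y⟩ = ∫_H ⟨x,v⟩⟨y,v⟩ dμ(v) for all x, y ∈ H, and let (e_n) be a Hilbert basis of H. Then for every F : H → ℝ twice continuously Fréchet differentiable with F, ∇F, ∇²F bounded, the Gaussian integration-by-parts (Stein) identity holds: ∫_H (∇F(u))(u) dμ(u) = ∫_H ∑_n ∇²F(u)(S e_n, e_n) dμ(u), where for each u the series ∑_n ∇²F(u)(S e_n, e_n) converges absolutely. -/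
open MeasureTheory Real ProbabilityTheory
open scoped RealInnerProductSpace

/-- The trace series of a bounded bilinear form against the covariance operator. -/
theorem trace_series
    {H : Type*} [NormedAddCommGroup H] [InnerProductSpace ℝ H] [CompleteSpace H]
    [SecondCountableTopology H] [MeasurableSpace H] [BorelSpace H]
    (μ : Measure H) [IsProbabilityMeasure μ]
    (hsq : Integrable (fun v : H => ‖v‖ ^ 2) μ)
    (S : H →L[ℝ] H)
    (hS : ∀ x y : H, ⟪S x, y⟫ = ∫ v, ⟪x, v⟫ * ⟪y, v⟫ ∂μ)
    (e : HilbertBasis ℕ ℝ H) (B : H →L[ℝ] H →L[ℝ] ℝ) :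
    (Summable fun n => |B (S (e n)) (e n)|) ∧
      ∑' n, B (S (e n)) (e n) = ∫ v, B v v ∂μ := by
  have hB : ∀ v y, B v y = ⟪(InnerProductSpace.toDual ℝ H).symm (B v), y⟫ := fun v y => by
    rw [InnerProductSpace.toDual_symm_apply]
  have hterm : ∀ n, B (S (e n)) (e n) = ∫ v, ⟪e n, v⟫ * B v (e n) ∂μ := by
    intro n
    have h1 : ∀ x, B x (e n) = ⟪(InnerProductSpace.toDual ℝ H).symm (B.flip (e n)), x⟫ := by
      intro x
      rw [InnerProductSpace.toDual_symm_apply]; rfl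
    simp_rw [h1]
    rw [real_inner_comm, hS]
  have hdom : ∀ n v, ‖⟪e n, v⟫ * B v (e n)‖ ≤ (‖⟪e n, v⟫‖ ^ 2 + ‖B v (e n)‖ ^ 2) / 2 := by
    intro n v
    rw [norm_mul]
    nlinarith [sq_nonneg (‖⟪e n, v⟫‖ - ‖B v (e n)‖)]
  have hen : ∀ n, ‖e n‖ = 1 := fun n => e.orthonormal.1 n
  have hBn : ∀ v, ‖(InnerProductSpace.toDual ℝ H).symm (B v)‖ ≤ ‖B‖ * ‖v‖ := fun v => by
    rw [LinearIsometryEquiv.norm_map]; exact B.le_opNorm v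
  have hpart : ∀ N v, ∑ n ∈ Finset.range N, ‖⟪e n, v⟫ * B v (e n)‖
      ≤ (1 + ‖B‖ ^ 2) / 2 * ‖v‖ ^ 2 := by
    intro N v
    have h1 := e.orthonormal.sum_inner_products_le v (s := Finset.range N)
    have h2 := e.orthonormal.sum_inner_products_le
      ((InnerProductSpace.toDual ℝ H).symm (B v)) (s := Finset.range N)
    have h3 : ‖(InnerProductSpace.toDual ℝ H).symm (B v)‖ ^ 2 ≤ (‖B‖ * ‖v‖) ^ 2 :=
      pow_le_pow_left₀ (norm_nonneg _) (hBn v) 2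
    have h4 : ∀ n, ‖⟪e n, (InnerProductSpace.toDual ℝ H).symm (B v)⟫‖ = ‖B v (e n)‖ := by
      intro n
      rw [hB v, real_inner_comm]
    simp_rw [h4] at h2
    calc _ ≤ ∑ n ∈ Finset.range N, (‖⟪e n, v⟫‖ ^ 2 + ‖B v (e n)‖ ^ 2) / 2 :=
          Finset.sum_le_sum fun n _ => hdom n v
      _ = (∑ n ∈ Finset.range N, ‖⟪e n, v⟫‖ ^ 2
          + ∑ n ∈ Finset.range N, ‖B v (e n)‖ ^ 2) / 2 := by
          rw [← Finset.sum_div, Finset.sum_add_distrib]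
      _ ≤ _ := by nlinarith
  have hint : ∀ n, Integrable (fun v => ⟪e n, v⟫ * B v (e n)) μ := by
    intro n
    refine (hsq.const_mul ((1 + ‖B‖ ^ 2) / 2)).mono' ?_ (.of_forall fun v => ?_)
    · exact Continuous.aestronglyMeasurable (by fun_prop)
    · refine le_trans ?_ (hpart (n + 1) v)
      exact Finset.single_le_sum (f := fun n => ‖⟪e n, v⟫ * B v (e n)‖)
        (fun _ _ => norm_nonneg _) (Finset.self_mem_range_succ n)
  have hsum : Summable fun n => ∫ v, ‖⟪e n, v⟫ * B v (e n)‖ ∂μ := by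
    refine summable_of_sum_range_le (c := ∫ v, (1 + ‖B‖ ^ 2) / 2 * ‖v‖ ^ 2 ∂μ)
      (fun n => integral_nonneg fun _ => norm_nonneg _) fun N => ?_
    rw [← integral_finsetSum _ fun n _ => (hint n).norm]
    exact integral_mono (integrable_finsetSum _ fun n _ => (hint n).norm)
      (hsq.const_mul _) (hpart N)
  constructor
  · refine hsum.of_nonneg_of_le (fun _ => abs_nonneg _) fun n => ?_
    rw [hterm]
    exact norm_integral_le_integral_norm (fun v => ⟪e n, v⟫ * B v (e n))
  · simp_rw [hterm]
    rw [(hasSum_integral_of_summable_integral_norm hint hsum).tsum_eq]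
    congr 1
    ext v
    rw [hB v v, ← (e.hasSum_inner_mul_inner _ v).tsum_eq]
    congr 1
    ext n
    rw [← hB, mul_comm]

set_option maxHeartbeats 2000000 in
/-- Stein identity in coordinate-free form, by rotation invariance. -/
theorem stein_rotation
    {H : Type*} [NormedAddCommGroup H] [InnerProductSpace ℝ H] [CompleteSpace H]
    [SecondCountableTopology H] [MeasurableSpace H] [BorelSpace H]
    (μ : Measure H) [IsGaussian μ] (hμ : ∀ L : H →L[ℝ] ℝ, ∫ v, L v ∂μ = 0)
    (G : H → H →L[ℝ] ℝ) (hG : ContDiff ℝ 1 G)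
    (C D : ℝ) (hC : ∀ u, ‖G u‖ ≤ C) (hD : ∀ u, ‖fderiv ℝ G u‖ ≤ D) :
    ∫ u, G u u ∂μ = ∫ u, ∫ v, fderiv ℝ G u v v ∂μ ∂μ := by
  have hC0 : 0 ≤ C := (norm_nonneg _).trans (hC 0)
  have hD0 : 0 ≤ D := (norm_nonneg (fderiv ℝ G 0)).trans (hD 0)
  have hGc : Continuous G := hG.continuous
  have hGc' : Continuous (fderiv ℝ G) := hG.continuous_fderiv (by norm_num)
  have hn : Integrable (fun v : H => ‖v‖) μ := (IsGaussian.integrable_id (μ := μ)).norm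
  have hsq : Integrable (fun v : H => ‖v‖ ^ 2) μ :=
    (IsGaussian.memLp_two_id (μ := μ)).integrable_norm_pow (by norm_num)
  have hn1 : Integrable (fun p : H × H => ‖p.1‖) (μ.prod μ) := hn.comp_fst μ
  have hn2 : Integrable (fun p : H × H => ‖p.2‖) (μ.prod μ) := hn.comp_snd μ
  have hs1 : Integrable (fun p : H × H => ‖p.1‖ ^ 2) (μ.prod μ) := hsq.comp_fst μ
  have hs2 : Integrable (fun p : H × H => ‖p.2‖ ^ 2) (μ.prod μ) := hsq.comp_snd μ
  have hGle : ∀ u w, ‖G u w‖ ≤ C * ‖w‖ := fun u w =>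
    ((G u).le_opNorm w).trans (by gcongr; exact hC u)
  have hDle : ∀ u v w, ‖fderiv ℝ G u v w‖ ≤ D * ‖v‖ * ‖w‖ := fun u v w =>
    ((fderiv ℝ G u).le_opNorm₂ v w).trans (by gcongr; exact hD u)
  let X : ℝ → H × H → H := fun θ p => cos θ • p.1 + sin θ • p.2
  let Y : ℝ → H × H → H := fun θ p => -sin θ • p.1 + cos θ • p.2
  have hXn : ∀ θ p, ‖X θ p‖ ≤ ‖p.1‖ + ‖p.2‖ := by
    intro θ p
    refine (norm_add_le _ _).trans (add_le_add ?_ ?_) <;> rw [norm_smul]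
    · exact mul_le_of_le_one_left (norm_nonneg _) (abs_cos_le_one θ)
    · exact mul_le_of_le_one_left (norm_nonneg _) (abs_sin_le_one θ)
  have hYn : ∀ θ p, ‖Y θ p‖ ≤ ‖p.1‖ + ‖p.2‖ := by
    intro θ p
    refine (norm_add_le _ _).trans (add_le_add ?_ ?_) <;> rw [norm_smul]
    · rw [norm_neg]
      exact mul_le_of_le_one_left (norm_nonneg _) (abs_sin_le_one θ)
    · exact mul_le_of_le_one_left (norm_nonneg _) (abs_cos_le_one θ)
  have hXd : ∀ θ p, HasDerivAt (fun t => X t p) (Y θ p) θ := fun θ p =>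
    ((hasDerivAt_cos θ).smul_const p.1).add ((hasDerivAt_sin θ).smul_const p.2)
  have hYd : ∀ θ p, HasDerivAt (fun t => Y t p) (-X θ p) θ := by
    intro θ p
    have := ((hasDerivAt_sin θ).neg.smul_const p.1).add ((hasDerivAt_cos θ).smul_const p.2)
    convert! this using 1
    simp only [X, neg_add, neg_smul]
  have hXc : ∀ θ, Continuous (X θ) := fun θ => by fun_prop
  have hYc : ∀ θ, Continuous (Y θ) := fun θ => by fun_prop
  have hGYc : ∀ θ, Continuous fun p => G (X θ p) (Y θ p) := fun θ =>
    (hGc.comp (hXc θ)).clm_apply (hYc θ)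
  have hbase : Integrable (fun p : H × H => G p.1 p.2) (μ.prod μ) := by
    refine (hn2.const_mul C).mono' ?_ (.of_forall fun p => hGle _ _)
    exact ((hGc.comp continuous_fst).clm_apply continuous_snd).aestronglyMeasurable
  -- the rotated expectation is constant
  have hzero : ∀ θ, ∫ p, G (X θ p) (Y θ p) ∂(μ.prod μ) = 0 := by
    intro θ
    have hrot := IsGaussian.map_rotation_eq_self_of_forall_strongDual_eq_zero (μ := μ) hμ θ
    have h1 : ∫ p, G p.1 p.2 ∂(μ.prod μ) = 0 := by
      rw [integral_prod _ hbase]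
      simp [hμ]
    have hGm : AEStronglyMeasurable (fun p : H × H => G p.1 p.2)
        (Measure.map (ContinuousLinearMap.rotation (E := H) θ) (μ.prod μ)) :=
      ((hGc.comp continuous_fst).clm_apply continuous_snd).aestronglyMeasurable
    rw [← hrot, integral_map (by fun_prop) hGm] at h1
    rw [← h1]
    congr 1
  have hder := hasDerivAt_integral_of_dominated_loc_of_deriv_le (μ := μ.prod μ) (x₀ := (0 : ℝ))
    (s := Set.univ) (F := fun θ p => G (X θ p) (Y θ p))
    (F' := fun θ p => fderiv ℝ G (X θ p) (Y θ p) (Y θ p) + G (X θ p) (-X θ p))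
    (bound := fun p => 2 * D * (‖p.1‖ ^ 2 + ‖p.2‖ ^ 2) + C * (‖p.1‖ + ‖p.2‖))
    Filter.univ_mem (.of_forall fun θ => (hGYc θ).aestronglyMeasurable)
    (by simpa [X, Y] using hbase)
    (((((hGc'.comp (hXc 0)).clm_apply (hYc 0)).clm_apply (hYc 0)).add
      ((hGc.comp (hXc 0)).clm_apply (hXc 0).neg)).aestronglyMeasurable)
    (.of_forall fun p θ _ => by
      refine (norm_add_le _ _).trans (add_le_add ?_ ?_)
      · refine (hDle _ _ _).trans ?_
        have h1 := hYn θ p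
        have h2 : ‖Y θ p‖ ^ 2 ≤ (‖p.1‖ + ‖p.2‖) ^ 2 := pow_le_pow_left₀ (norm_nonneg _) h1 2
        have h3 : ‖Y θ p‖ ^ 2 ≤ 2 * (‖p.1‖ ^ 2 + ‖p.2‖ ^ 2) := by
          nlinarith [sq_nonneg (‖p.1‖ - ‖p.2‖)]
        calc D * ‖Y θ p‖ * ‖Y θ p‖ = D * ‖Y θ p‖ ^ 2 := by ring
          _ ≤ D * (2 * (‖p.1‖ ^ 2 + ‖p.2‖ ^ 2)) := by gcongr
          _ = _ := by ring
      · refine (hGle _ _).trans ?_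
        rw [norm_neg]
        gcongr
        exact hXn θ p)
    (((hs1.add hs2).const_mul (2 * D)).add ((hn1.add hn2).const_mul C))
    (.of_forall fun p θ _ => by
      have hGd : HasFDerivAt G (fderiv ℝ G (X θ p)) (X θ p) :=
        (hG.differentiable (by norm_num) _).hasFDerivAt
      exact (hGd.comp_hasDerivAt θ (hXd θ p)).clm_apply (hYd θ p))
  have hd := hder.2
  simp_rw [hzero] at hd
  have h0 := hd.unique (hasDerivAt_const (0 : ℝ) (0 : ℝ))
  simp only [X, Y, cos_zero, sin_zero, one_smul, zero_smul, add_zero, neg_zero, zero_add,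
    map_neg] at h0
  have hi1 : Integrable (fun p : H × H => fderiv ℝ G p.1 p.2 p.2) (μ.prod μ) := by
    refine (hs2.const_mul D).mono' ?_ (.of_forall fun p => ?_)
    · exact (((hGc'.comp continuous_fst).clm_apply continuous_snd).clm_apply
        continuous_snd).aestronglyMeasurable
    · exact (hDle _ _ _).trans (by rw [mul_assoc, sq])
  have hi2 : Integrable (fun p : H × H => G p.1 p.1) (μ.prod μ) := by
    refine (hn1.const_mul C).mono' ?_ (.of_forall fun p => hGle _ _)
    exact ((hGc.comp continuous_fst).clm_apply continuous_fst).aestronglyMeasurable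
  simp only [← sub_eq_add_neg] at h0
  rw [integral_sub hi1 hi2, integral_prod _ hi1, integral_prod _ hi2] at h0
  simp only [integral_const, probReal_univ, one_smul] at h0
  linarith

/-- Gaussian integration by parts (Stein identity) on a separable Hilbert space: if `μ` is a
centered Gaussian measure with covariance operator `S` and `(e_n)` is a Hilbert basis, then
for `F : H → ℝ` of class `C²` with `F, ∇F, ∇²F` bounded, the series
`∑_n ∇²F(u)(S e_n, e_n)` converges absolutely for each `u` and
`∫ ∇F(u)(u) dμ(u) = ∫ ∑_n ∇²F(u)(S e_n, e_n) dμ(u)`. -/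
theorem gaussian_integration_by_parts
    {H : Type*} [NormedAddCommGroup H] [InnerProductSpace ℝ H] [CompleteSpace H]
    [TopologicalSpace.SeparableSpace H] [MeasurableSpace H] [BorelSpace H]
    (μ : Measure H) [IsProbabilityMeasure μ]
    (hgauss : ∀ ℓ : H →L[ℝ] ℝ, ∃ v : NNReal, Measure.map ℓ μ = gaussianReal 0 v)
    (S : H →L[ℝ] H)
    (hS : ∀ x y : H, ⟪S x, y⟫ = ∫ v, ⟪x, v⟫ * ⟪y, v⟫ ∂μ)
    (e : HilbertBasis ℕ ℝ H)
    (F : H → ℝ) (hF : ContDiff ℝ 2 F)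
    (hFb : ∀ i ≤ 2, ∃ C, ∀ u, ‖iteratedFDeriv ℝ i F u‖ ≤ C) :
    (∀ u : H, Summable fun n => |iteratedFDeriv ℝ 2 F u ![S (e n), e n]|) ∧
    ∫ u, fderiv ℝ F u u ∂μ
      = ∫ u, ∑' n, iteratedFDeriv ℝ 2 F u ![S (e n), e n] ∂μ := by
  have : SecondCountableTopology H := UniformSpace.secondCountable_of_separable H
  have hG : IsGaussian μ := isGaussian_of_map_eq_gaussianReal fun L =>
    ⟨0, (hgauss L).choose, (hgauss L).choose_spec⟩
  have hμ : ∀ L : H →L[ℝ] ℝ, ∫ v, L v ∂μ = 0 := by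
    intro L
    obtain ⟨v, hv⟩ := hgauss L
    have h := integral_id_gaussianReal (μ := 0) (v := v)
    rwa [← hv, integral_map (by fun_prop) (by fun_prop)] at h
  have hsq : Integrable (fun v : H => ‖v‖ ^ 2) μ :=
    (IsGaussian.memLp_two_id (μ := μ)).integrable_norm_pow (by norm_num)
  have htr := fun u => trace_series μ hsq S hS e (fderiv ℝ (fderiv ℝ F) u)
  have hit : ∀ u n, iteratedFDeriv ℝ 2 F u ![S (e n), e n]
      = fderiv ℝ (fderiv ℝ F) u (S (e n)) (e n) := fun u n => by
    rw [iteratedFDeriv_two_apply]; rfl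
  simp_rw [hit]
  refine ⟨fun u => (htr u).1, ?_⟩
  simp_rw [fun u => (htr u).2]
  obtain ⟨C, hC⟩ := hFb 1 (by norm_num)
  obtain ⟨D, hD⟩ := hFb 2 le_rfl
  refine stein_rotation μ hμ (fderiv ℝ F) (hF.fderiv_right (by norm_num)) C D
    (fun u => ?_) (fun u => ?_)
  · rw [← norm_iteratedFDeriv_one]; exact hC u
  · rw [← norm_iteratedFDeriv_one, norm_iteratedFDeriv_fderiv]; exact hD u
end

section
/- Let μ be a centered Gaussian probability measure on a separable real Hilbert space H with covariance operator S (so ⟨S x, y⟩ = ∫_H ⟨x,v⟩⟨y,v⟩ dμ(v)), and let (e_n) be a Hilbert basis of H. Then for every F : H → ℝ twice continuously Fréchet differentiable with F, ∇F, ∇²F bounded, every u ∈ H and every t ≥ 0: P_t F(u) − F(u) = ∫_0^t [ ∑_n ∇²(P_s F)(u)(S e_n, e_n) − (∇(P_s F)(u))(u) ] ds; that is, the Mehler semigroup P_t has infinitesimal generator L F(u) = trace(S ∘ ∇²F(u)) − (∇F(u))(u). -/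
open MeasureTheory Real ProbabilityTheory
open scoped RealInnerProductSpace

section MehlerAux

set_option maxSynthPendingDepth 3

variable {H : Type*} [NormedAddCommGroup H] [InnerProductSpace ℝ H] [CompleteSpace H]
    [TopologicalSpace.SeparableSpace H] [MeasurableSpace H] [BorelSpace H]

lemma mehler_aux_int (μ : Measure H) [IsGaussian μ] :
    Integrable (fun x : H => ‖x‖) μ ∧ Integrable (fun x : H => ‖x‖ ^ 2) μ := by
  have : SecondCountableTopology H := UniformSpace.secondCountable_of_separable H
  refine ⟨(IsGaussian.integrable_id (μ := μ)).norm, ?_⟩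
  exact (IsGaussian.memLp_two_id (μ := μ)).integrable_norm_pow (by norm_num)

lemma mehler_aux_stein (μ : Measure H) [IsGaussian μ] (hμ : ∫ x, x ∂μ = 0)
    (D : H → H →L[ℝ] ℝ) (D' : H → H →L[ℝ] H →L[ℝ] ℝ) (hD : ∀ x, HasFDerivAt D (D' x) x)
    (hc : Continuous D') (C₁ C₂ : ℝ) (h1 : ∀ x, ‖D x‖ ≤ C₁) (h2 : ∀ x, ‖D' x‖ ≤ C₂) :
    ∫ x, D x x ∂μ = ∫ y, (∫ x, D' x ∂μ) y y ∂μ := by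
  have : SecondCountableTopology H := UniformSpace.secondCountable_of_separable H
  obtain ⟨i1, i2⟩ := mehler_aux_int μ
  have hC1 : 0 ≤ C₁ := (norm_nonneg _).trans (h1 0)
  have hC2 : 0 ≤ C₂ := le_trans (norm_nonneg (D' 0)) (h2 0)
  have hDc : Continuous D := continuous_iff_continuousAt.2 fun x => (hD x).continuousAt
  let f : ℝ → H × H → ℝ := fun θ p => D (cos θ • p.1 + sin θ • p.2) (-sin θ • p.1 + cos θ • p.2)
  let f' : ℝ → H × H → ℝ := fun θ p =>
    D' (cos θ • p.1 + sin θ • p.2) (-sin θ • p.1 + cos θ • p.2) (-sin θ • p.1 + cos θ • p.2)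
      + D (cos θ • p.1 + sin θ • p.2) (-cos θ • p.1 + -sin θ • p.2)
  have n1 : Integrable (fun p : H × H => ‖p.1‖) (μ.prod μ) := i1.comp_fst μ
  have n2 : Integrable (fun p : H × H => ‖p.2‖) (μ.prod μ) := i1.comp_snd μ
  have m1 : Integrable (fun p : H × H => ‖p.1‖ ^ 2) (μ.prod μ) := i2.comp_fst μ
  have m2 : Integrable (fun p : H × H => ‖p.2‖ ^ 2) (μ.prod μ) := i2.comp_snd μ
  let bd : H × H → ℝ := fun p => C₂ * (2 * (‖p.1‖ ^ 2 + ‖p.2‖ ^ 2)) + C₁ * (‖p.1‖ + ‖p.2‖)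
  have hbd : Integrable bd (μ.prod μ) :=
    (((m1.add m2).const_mul 2).const_mul C₂).add ((n1.add n2).const_mul C₁)
  have hcomb : ∀ (a b : ℝ) (p : H × H), |a| ≤ 1 → |b| ≤ 1 →
      ‖a • p.1 + b • p.2‖ ≤ ‖p.1‖ + ‖p.2‖ := by
    intro a b p ha hb
    refine (norm_add_le _ _).trans ?_
    rw [norm_smul, norm_smul, Real.norm_eq_abs, Real.norm_eq_abs]
    have := mul_le_of_le_one_left (norm_nonneg p.1) ha
    have := mul_le_of_le_one_left (norm_nonneg p.2) hb
    linarith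
  have hfc : ∀ θ, Continuous (f θ) := by
    intro θ
    have : Continuous fun p : H × H => D (cos θ • p.1 + sin θ • p.2) :=
      hDc.comp (by fun_prop)
    exact this.clm_apply (by fun_prop)
  have hfc' : ∀ θ, Continuous (f' θ) := by
    intro θ
    have a1 : Continuous fun p : H × H => D (cos θ • p.1 + sin θ • p.2) :=
      hDc.comp (by fun_prop)
    have a2 : Continuous fun p : H × H => D' (cos θ • p.1 + sin θ • p.2) :=
      hc.comp (by fun_prop)
    exact ((a2.clm_apply (by fun_prop)).clm_apply (by fun_prop)).add (a1.clm_apply (by fun_prop))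
  have hfi : Integrable (f 0) (μ.prod μ) := by
    refine Integrable.mono' (n2.const_mul C₁) (hfc 0).aestronglyMeasurable ?_
    refine Filter.Eventually.of_forall fun p => ?_
    simp only [f, cos_zero, sin_zero, one_smul, zero_smul, neg_zero, zero_add, add_zero]
    exact (D p.1).le_of_opNorm_le (h1 _) _
  have hzero : ∀ θ, ∫ p, f θ p ∂(μ.prod μ) = 0 := by
    have h0 : ∫ p, f 0 p ∂(μ.prod μ) = 0 := by
      rw [integral_prod _ hfi]
      simp only [f, cos_zero, sin_zero, one_smul, zero_smul, neg_zero, zero_add, add_zero]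
      refine integral_eq_zero_of_ae (Filter.Eventually.of_forall fun x => ?_)
      show ∫ y, D x y ∂μ = 0
      have hq := (D x).integral_comp_comm (IsGaussian.integrable_id (μ := μ))
      simp only [id, hμ, map_zero] at hq
      exact hq
    intro θ
    rw [← h0]
    conv_rhs => rw [← IsGaussian.map_rotation_eq_self (μ := μ) (by simpa using hμ) θ]
    rw [integral_map (by fun_prop) (hfc 0).aestronglyMeasurable]
    simp [f, ContinuousLinearMap.rotation_apply]
  have hder := (hasDerivAt_integral_of_dominated_loc_of_deriv_le (μ := μ.prod μ) (F := f) (F' := f')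
    (x₀ := 0) (s := Set.univ) (bound := bd) Filter.univ_mem
    (Filter.Eventually.of_forall fun θ => (hfc θ).aestronglyMeasurable) hfi
    (hfc' 0).aestronglyMeasurable ?_ hbd ?_).2
  · have hz : (fun θ => ∫ p, f θ p ∂(μ.prod μ)) = fun _ => 0 := funext hzero
    rw [hz] at hder
    have hz2 := hder.unique (hasDerivAt_const (0:ℝ) (0:ℝ))
    simp only [f', cos_zero, sin_zero, one_smul, zero_smul, neg_zero, zero_add, add_zero, neg_smul,
      map_neg] at hz2
    have j1 : Integrable (fun p : H × H => D' p.1 p.2 p.2) (μ.prod μ) := by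
      refine Integrable.mono' (m2.const_mul C₂) ?_ ?_
      · refine Continuous.aestronglyMeasurable ?_
        exact ((hc.comp continuous_fst).clm_apply continuous_snd).clm_apply continuous_snd
      · refine Filter.Eventually.of_forall fun p => ?_
        refine ((D' p.1).le_opNorm₂ _ _).trans ?_
        rw [mul_assoc, ← sq]
        exact mul_le_mul_of_nonneg_right (h2 _) (by positivity)
    have j2' : Integrable (fun x : H => D x x) μ := by
      refine Integrable.mono' (i1.const_mul C₁) ?_ ?_
      · exact (hDc.clm_apply continuous_id).aestronglyMeasurable
      · exact Filter.Eventually.of_forall fun p => (D p).le_of_opNorm_le (h1 _) _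
    have j2 : Integrable (fun p : H × H => D p.1 p.1) (μ.prod μ) := j2'.comp_fst μ
    have hk : Integrable D' μ := Integrable.of_bound hc.aestronglyMeasurable C₂
      (Filter.Eventually.of_forall h2)
    have hz3 : ∫ p, D' p.1 p.2 p.2 ∂(μ.prod μ) - ∫ p, D p.1 p.1 ∂(μ.prod μ) = 0 := by
      rw [← integral_sub j1 j2]; simpa [sub_eq_add_neg] using hz2
    rw [integral_prod_symm _ j1, integral_fun_fst (fun x => D x x)] at hz3
    simp only [probReal_univ, one_smul] at hz3
    rw [← sub_eq_zero.1 hz3]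
    refine integral_congr_ae (Filter.Eventually.of_forall fun y => ?_)
    show ∫ x, D' x y y ∂μ = (∫ x, D' x ∂μ) y y
    rw [ContinuousLinearMap.integral_apply hk, ContinuousLinearMap.integral_apply]
    exact hk.apply_continuousLinearMap y
  · refine Filter.Eventually.of_forall fun p θ _ => ?_
    have b1 := hcomb (-sin θ) (cos θ) p (by rw [abs_neg]; exact abs_sin_le_one θ) (abs_cos_le_one θ)
    have b2 := hcomb (-cos θ) (-sin θ) p (by rw [abs_neg]; exact abs_cos_le_one θ)
      (by rw [abs_neg]; exact abs_sin_le_one θ)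
    refine (norm_add_le _ _).trans (add_le_add ?_ ?_)
    · refine ((D' _).le_opNorm₂ _ _).trans ?_
      rw [mul_assoc]
      refine mul_le_mul (h2 _) ?_ (by positivity) hC2
      have := mul_le_mul b1 b1 (norm_nonneg _) (by positivity)
      nlinarith [sq_nonneg (‖p.1‖ - ‖p.2‖)]
    · exact ((D _).le_of_opNorm_le (h1 _) _).trans (mul_le_mul_of_nonneg_left b2 hC1)
  · refine Filter.Eventually.of_forall fun p θ _ => ?_
    have d1 : HasDerivAt (fun θ : ℝ => cos θ • p.1 + sin θ • p.2)
        (-sin θ • p.1 + cos θ • p.2) θ :=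
      ((hasDerivAt_cos θ).smul_const _).add ((hasDerivAt_sin θ).smul_const _)
    have d2 : HasDerivAt (fun θ : ℝ => -sin θ • p.1 + cos θ • p.2)
        (-cos θ • p.1 + -sin θ • p.2) θ :=
      ((hasDerivAt_sin θ).neg.smul_const _).add ((hasDerivAt_cos θ).smul_const _)
    exact ((hD _).comp_hasDerivAt θ d1).clm_apply d2

lemma mehler_aux_trace (μ : Measure H) [IsGaussian μ] (S : H →L[ℝ] H)
    (hS : ∀ x y : H, ⟪S x, y⟫ = ∫ v, ⟪x, v⟫ * ⟪y, v⟫ ∂μ)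
    (e : HilbertBasis ℕ ℝ H) (B : H →L[ℝ] H →L[ℝ] ℝ) :
    ∑' n, B (S (e n)) (e n) = ∫ y, B y y ∂μ := by
  have : SecondCountableTopology H := UniformSpace.secondCountable_of_separable H
  obtain ⟨i1, i2⟩ := mehler_aux_int μ
  let T : H → H := fun y => (InnerProductSpace.toDual ℝ H).symm (B y)
  have hT : ∀ y z, ⟪T y, z⟫ = B y z := fun y z => InnerProductSpace.toDual_symm_apply
  have hTn : ∀ y, ‖T y‖ ≤ ‖B‖ * ‖y‖ := fun y => by
    simp only [T, LinearIsometryEquiv.norm_map]; exact B.le_opNorm y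
  have hsq : ∀ z : H, HasSum (fun n => ⟪z, e n⟫ ^ 2) (‖z‖ ^ 2) := fun z => by
    have := e.hasSum_inner_mul_inner z z
    rw [real_inner_self_eq_norm_sq] at this
    refine this.congr_fun ?_
    intro n; rw [real_inner_comm z (e n), sq]
  have key : HasSum (fun n => ∫ y, B y (e n) * ⟪e n, y⟫ ∂μ) (∫ y, B y y ∂μ) := by
    have hb : ∀ y, HasSum (fun n => (⟪T y, e n⟫ ^ 2 + ⟪y, e n⟫ ^ 2)) (‖T y‖ ^ 2 + ‖y‖ ^ 2) :=
      fun y => (hsq (T y)).add (hsq y)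
    refine hasSum_integral_of_dominated_convergence
      (fun n y => (⟪T y, e n⟫ ^ 2 + ⟪y, e n⟫ ^ 2)) ?_ ?_ ?_ ?_ ?_
    · intro n; exact Continuous.aestronglyMeasurable (by fun_prop)
    · intro n
      refine Filter.Eventually.of_forall fun y => ?_
      rw [hT, Real.norm_eq_abs, abs_mul, real_inner_comm]
      rw [← sq_abs (B y (e n)), ← sq_abs (inner ℝ y (e n))]
      nlinarith [sq_nonneg (|B y (e n)| - |inner ℝ y (e n)|), sq_nonneg (|B y (e n)|), sq_nonneg |inner ℝ y (e n)|]
    · exact Filter.Eventually.of_forall fun y => (hb y).summable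
    · simp_rw [fun y => (hb y).tsum_eq]
      refine Integrable.add ?_ i2
      refine Integrable.mono' (i2.const_mul (‖B‖ ^ 2)) ?_ ?_
      · refine Continuous.aestronglyMeasurable ?_
        simp only [T, LinearIsometryEquiv.norm_map]; fun_prop
      · refine Filter.Eventually.of_forall fun y => ?_
        rw [Real.norm_of_nonneg (by positivity), ← mul_pow]
        exact pow_le_pow_left₀ (norm_nonneg _) (hTn y) 2
    · refine Filter.Eventually.of_forall fun y => ?_
      have := e.hasSum_inner_mul_inner (T y) y
      simpa only [hT] using this
  rw [← key.tsum_eq]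
  refine tsum_congr fun n => ?_
  let b : H := (InnerProductSpace.toDual ℝ H).symm (B.flip (e n))
  have hbv : ∀ z, ⟪b, z⟫ = B z (e n) := fun z => by
    simp only [b, InnerProductSpace.toDual_symm_apply, ContinuousLinearMap.flip_apply]
  rw [← hbv, real_inner_comm, hS]
  refine integral_congr_ae (Filter.Eventually.of_forall fun y => ?_)
  simp only [hbv]; ring

lemma mehler_aux_fderiv {E : Type*} [NormedAddCommGroup E] [NormedSpace ℝ E]
    (μ : Measure H) [IsProbabilityMeasure μ] (a b : ℝ)
    (G : H → E) (G' : H → H →L[ℝ] E) (hG : ∀ x, HasFDerivAt G (G' x) x) (hc : Continuous G')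
    (C₀ C₁ : ℝ) (h0 : ∀ x, ‖G x‖ ≤ C₀) (h1 : ∀ x, ‖G' x‖ ≤ C₁) (u : H) :
    HasFDerivAt (fun u => ∫ v, G (a • u + b • v) ∂μ) (a • ∫ v, G' (a • u + b • v) ∂μ) u := by
  have : SecondCountableTopology H := UniformSpace.secondCountable_of_separable H
  have hGc : Continuous G := continuous_iff_continuousAt.2 fun x => (hG x).continuousAt
  rw [← integral_smul]
  refine hasFDerivAt_integral_of_dominated_of_fderiv_le (s := Set.univ)
    (F' := fun u v => a • G' (a • u + b • v)) (bound := fun _ => |a| * C₁) Filter.univ_mem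
    ?_ ?_ ?_ ?_ (integrable_const _) ?_
  · exact Filter.Eventually.of_forall fun x =>
      (hGc.comp (by fun_prop : Continuous fun v : H => a • x + b • v)).aestronglyMeasurable
  · exact Integrable.of_bound
      (hGc.comp (by fun_prop : Continuous fun v : H => a • u + b • v)).aestronglyMeasurable C₀
      (Filter.Eventually.of_forall fun v => h0 _)
  · exact ((hc.comp (by fun_prop : Continuous fun v : H => a • u + b • v)).const_smul
      a).aestronglyMeasurable
  · refine Filter.Eventually.of_forall fun v x _ => ?_
    rw [norm_smul, Real.norm_eq_abs]
    exact mul_le_mul_of_nonneg_left (h1 _) (abs_nonneg a)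
  · refine Filter.Eventually.of_forall fun v x _ => ?_
    have hd : HasFDerivAt (fun x : H => a • x + b • v) (a • ContinuousLinearMap.id ℝ H) x :=
      ((hasFDerivAt_id x).const_smul a).add_const _
    have := (hG (a • x + b • v)).comp x hd
    rwa [ContinuousLinearMap.comp_smul, ContinuousLinearMap.comp_id] at this

/-- Time derivative of the Mehler semigroup. -/
lemma mehler_aux_time (μ : Measure H) [IsGaussian μ] (hμ : ∫ x, x ∂μ = 0)
    (F : H → ℝ) (D : H → H →L[ℝ] ℝ) (D' : H → H →L[ℝ] H →L[ℝ] ℝ)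
    (hF : ∀ x, HasFDerivAt F (D x) x) (hD : ∀ x, HasFDerivAt D (D' x) x)
    (hc : Continuous D') (C₀ C₁ C₂ : ℝ) (h0 : ∀ x, ‖F x‖ ≤ C₀) (h1 : ∀ x, ‖D x‖ ≤ C₁)
    (h2 : ∀ x, ‖D' x‖ ≤ C₂) (u : H) (s : ℝ) (hs : 0 < s) :
    HasDerivAt (fun s => ∫ v, F (exp (-s) • u + √(1 - exp (-2 * s)) • v) ∂μ)
      (exp (-2 * s) * ∫ y, (∫ v, D' (exp (-s) • u + √(1 - exp (-2 * s)) • v) ∂μ) y y ∂μ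
        - exp (-s) * (∫ v, D (exp (-s) • u + √(1 - exp (-2 * s)) • v) ∂μ) u) s := by
  have : SecondCountableTopology H := UniformSpace.secondCountable_of_separable H
  obtain ⟨i1, i2⟩ := mehler_aux_int μ
  have hFc : Continuous F := continuous_iff_continuousAt.2 fun x => (hF x).continuousAt
  have hDc : Continuous D := continuous_iff_continuousAt.2 fun x => (hD x).continuousAt
  have hC1 : 0 ≤ C₁ := (norm_nonneg _).trans (h1 0)
  have hpos : ∀ r : ℝ, 0 < r → 0 < √(1 - exp (-2 * r)) := by
    intro r hr
    refine sqrt_pos.2 (sub_pos.2 ?_)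
    rw [exp_lt_one_iff]; linarith
  have hlin : ∀ r : ℝ, Continuous fun v : H => exp (-r) • u + √(1 - exp (-2 * r)) • v := by
    intro r; fun_prop
  let f' : ℝ → H → ℝ := fun r v => D (exp (-r) • u + √(1 - exp (-2 * r)) • v)
    (-exp (-r) • u + (exp (-2 * r) / √(1 - exp (-2 * r))) • v)
  have hder := (hasDerivAt_integral_of_dominated_loc_of_deriv_le (μ := μ)
    (F := fun r v => F (exp (-r) • u + √(1 - exp (-2 * r)) • v)) (F' := f')
    (x₀ := s) (s := Set.Ioi (s / 2))
    (bound := fun v => C₁ * (‖u‖ + (1 / √(1 - exp (-2 * (s / 2)))) * ‖v‖))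
    (Ioi_mem_nhds (by linarith))
    (Filter.Eventually.of_forall fun θ => (hFc.comp (hlin θ)).aestronglyMeasurable)
    (Integrable.of_bound (hFc.comp (hlin s)).aestronglyMeasurable C₀
      (Filter.Eventually.of_forall fun v => h0 _))
    ((hDc.comp (hlin s)).clm_apply (by fun_prop)).aestronglyMeasurable ?_ ?_ ?_).2
  · refine hder.congr_deriv ?_
    symm
    set a := exp (-s)
    set b := √(1 - exp (-2 * s)) with hb
    have hb0 : 0 < b := hpos s hs
    have hst := mehler_aux_stein μ hμ (fun v => D (a • u + b • v))
      (fun v => b • D' (a • u + b • v)) (fun x => by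
        have hd : HasFDerivAt (fun x : H => a • u + b • x) (b • ContinuousLinearMap.id ℝ H) x :=
          ((hasFDerivAt_id x).const_smul b).const_add _
        have := (hD (a • u + b • x)).comp x hd
        rwa [ContinuousLinearMap.comp_smul, ContinuousLinearMap.comp_id] at this)
      ((hc.comp (hlin s)).const_smul b) C₁ (b * C₂) (fun x => h1 _) (fun x => by
        rw [norm_smul, Real.norm_of_nonneg hb0.le]
        exact mul_le_mul_of_nonneg_left (h2 _) hb0.le)
    rw [integral_smul] at hst
    simp only [smul_apply, smul_eq_mul] at hst
    rw [integral_const_mul] at hst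
    have hDi : Integrable (fun v => D (a • u + b • v)) μ :=
      Integrable.of_bound (hDc.comp (hlin s)).aestronglyMeasurable C₁
        (Filter.Eventually.of_forall fun v => h1 _)
    have j1 : Integrable (fun v => D (a • u + b • v) u) μ := hDi.apply_continuousLinearMap u
    have j2 : Integrable (fun v => D (a • u + b • v) v) μ := by
      refine Integrable.mono' (i1.const_mul C₁) ?_ ?_
      · exact ((hDc.comp (hlin s)).clm_apply continuous_id).aestronglyMeasurable
      · exact Filter.Eventually.of_forall fun p => (D _).le_of_opNorm_le (h1 _) _
    have : ∫ v, f' s v ∂μ = -a * ∫ v, D (a • u + b • v) u ∂μ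
        + exp (-2 * s) / b * ∫ v, D (a • u + b • v) v ∂μ := by
      rw [← integral_const_mul, ← integral_const_mul, ← integral_add (j1.const_mul _)
        (j2.const_mul _)]
      refine integral_congr_ae (Filter.Eventually.of_forall fun v => ?_)
      simp only [f', map_add, map_smul, smul_eq_mul, a, b]
    rw [this, hst, ContinuousLinearMap.integral_apply hDi]
    field_simp
    ring
  · refine Filter.Eventually.of_forall fun v r hr => ?_
    have hr' : s / 2 < r := hr
    have hr0 : 0 < r := by linarith
    refine ((D _).le_of_opNorm_le (h1 _) _).trans (mul_le_mul_of_nonneg_left ?_ hC1)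
    refine (norm_add_le _ _).trans (add_le_add ?_ ?_)
    · rw [norm_smul, norm_neg, Real.norm_of_nonneg (exp_pos _).le]
      exact mul_le_of_le_one_left (norm_nonneg _) (exp_le_one_iff.2 (by linarith))
    · rw [norm_smul, Real.norm_of_nonneg (div_nonneg (exp_pos _).le (sqrt_nonneg _))]
      refine mul_le_mul_of_nonneg_right ?_ (norm_nonneg _)
      refine div_le_div₀ zero_le_one (exp_le_one_iff.2 (by linarith)) (hpos _ (by linarith)) ?_
      refine sqrt_le_sqrt ?_
      have := exp_le_exp.2 (show -2 * r ≤ -2 * (s / 2) by linarith)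
      linarith
  · exact ((integrable_const _).add (i1.const_mul _)).const_mul _
  · refine Filter.Eventually.of_forall fun v r hr => ?_
    have hr' : s / 2 < r := hr
    have hr0 : 0 < r := by linarith
    have e1 : HasDerivAt (fun r : ℝ => exp (-r)) (-exp (-r)) r := by
      simpa using (hasDerivAt_neg r).exp
    have e2 : HasDerivAt (fun r : ℝ => √(1 - exp (-2 * r)))
        (exp (-2 * r) / √(1 - exp (-2 * r))) r := by
      have k : HasDerivAt (fun r : ℝ => 1 - exp (-2 * r)) (2 * exp (-2 * r)) r := by
        have := (((hasDerivAt_id r).const_mul (-2)).exp).const_sub 1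
        refine this.congr_deriv ?_
        simp only [id]; ring
      have := k.sqrt (sqrt_pos.1 (hpos r hr0)).ne'
      refine this.congr_deriv ?_
      have := (hpos r hr0).ne'
      field_simp
    exact (hF _).comp_hasDerivAt r ((e1.smul_const u).add (e2.smul_const v))

lemma mehler_aux_cont {E : Type*} [NormedAddCommGroup E] [NormedSpace ℝ E]
    (μ : Measure H) [IsProbabilityMeasure μ] (G : H → E) (hG : Continuous G) (C : ℝ)
    (h0 : ∀ x, ‖G x‖ ≤ C) (u : H) :
    Continuous fun s : ℝ => ∫ v, G (exp (-s) • u + √(1 - exp (-2 * s)) • v) ∂μ := by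
  have : SecondCountableTopology H := UniformSpace.secondCountable_of_separable H
  refine continuous_of_dominated (bound := fun _ => C) ?_ ?_ (integrable_const _) ?_
  · intro s
    exact (hG.comp (by fun_prop : Continuous fun v : H =>
      exp (-s) • u + √(1 - exp (-2 * s)) • v)).aestronglyMeasurable
  · exact fun s => Filter.Eventually.of_forall fun v => h0 _
  · exact Filter.Eventually.of_forall fun v => hG.comp (by fun_prop)

end MehlerAux

theorem mehler_semigroup_generator
    {H : Type*} [NormedAddCommGroup H] [InnerProductSpace ℝ H] [CompleteSpace H]
    [TopologicalSpace.SeparableSpace H] [MeasurableSpace H] [BorelSpace H]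
    (μ : Measure H) [IsProbabilityMeasure μ]
    (hgauss : ∀ ℓ : H →L[ℝ] ℝ, ∃ v : NNReal, Measure.map ℓ μ = gaussianReal 0 v)
    (S : H →L[ℝ] H)
    (hS : ∀ x y : H, ⟪S x, y⟫ = ∫ v, ⟪x, v⟫ * ⟪y, v⟫ ∂μ)
    (e : HilbertBasis ℕ ℝ H)
    (F : H → ℝ) (hF : ContDiff ℝ 2 F)
    (hFb : ∀ i ≤ 2, ∃ C, ∀ u, ‖iteratedFDeriv ℝ i F u‖ ≤ C)
    (P : ℝ → (H → ℝ) → H → ℝ)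
    (hP : ∀ t G u, P t G u
      = ∫ v, G (Real.exp (-t) • u + Real.sqrt (1 - Real.exp (-2 * t)) • v) ∂μ)
    (u : H) (t : ℝ) (ht : 0 ≤ t) :
    P t F u - F u
      = ∫ s in (0:ℝ)..t,
          ((∑' n, iteratedFDeriv ℝ 2 (P s F) u ![S (e n), e n])
            - fderiv ℝ (P s F) u u) := by
  have : SecondCountableTopology H := UniformSpace.secondCountable_of_separable H
  have hG : IsGaussian μ := isGaussian_of_map_eq_gaussianReal fun L => ⟨0, hgauss L⟩
  have hμ : ∫ x, x ∂μ = 0 := by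
    refine ext_inner_left ℝ fun w => ?_
    have h1 := IsGaussian.integral_dual (μ := μ) (innerSL ℝ w)
    obtain ⟨v, hv⟩ := hgauss (innerSL ℝ w)
    have h2 : ∫ x, x ∂(μ.map (innerSL ℝ w)) = μ[innerSL ℝ w] :=
      integral_map (by fun_prop) (by fun_prop)
    rw [hv, integral_id_gaussianReal] at h2
    rw [inner_zero_right, ← innerSL_apply_apply ℝ, ← h1, ← h2]
  obtain ⟨C₀, h0⟩ := hFb 0 (by norm_num)
  obtain ⟨C₁, h1⟩ := hFb 1 (by norm_num)
  obtain ⟨C₂, h2⟩ := hFb 2 le_rfl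
  have hDc1 : ContDiff ℝ 1 (fderiv ℝ F) := hF.fderiv_right (by norm_num)
  have hFd : ∀ x, HasFDerivAt F (fderiv ℝ F x) x := fun x =>
    (hF.differentiable (by norm_num) x).hasFDerivAt
  have hDd : ∀ x, HasFDerivAt (fderiv ℝ F) (fderiv ℝ (fderiv ℝ F) x) x := fun x =>
    (hDc1.differentiable (by norm_num) x).hasFDerivAt
  have hc : Continuous (fderiv ℝ (fderiv ℝ F)) := hDc1.continuous_fderiv (by norm_num)
  simp only [norm_iteratedFDeriv_zero] at h0
  simp only [norm_iteratedFDeriv_one] at h1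
  replace h2 : ∀ x, ‖fderiv ℝ (fderiv ℝ F) x‖ ≤ C₂ := fun x => by
    rw [← norm_iteratedFDeriv_one, norm_iteratedFDeriv_fderiv]; exact h2 x
  generalize fderiv ℝ (fderiv ℝ F) = D' at *
  generalize fderiv ℝ F = D at *
  obtain ⟨i1, i2⟩ := mehler_aux_int μ
  have hPs : ∀ s, P s F = fun u => ∫ v, F (exp (-s) • u + √(1 - exp (-2 * s)) • v) ∂μ :=
    fun s => funext fun u => hP s F u
  have hd1 : ∀ s, fderiv ℝ (P s F)
      = fun u => exp (-s) • ∫ v, D (exp (-s) • u + √(1 - exp (-2 * s)) • v) ∂μ := by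
    intro s; funext x
    rw [hPs]
    exact (mehler_aux_fderiv μ _ _ F D hFd hDc1.continuous C₀ C₁ h0 h1 x).fderiv
  have hd2 : ∀ s x, fderiv ℝ (fderiv ℝ (P s F)) x
      = exp (-s) • exp (-s) • ∫ v, D' (exp (-s) • x + √(1 - exp (-2 * s)) • v) ∂μ := by
    intro s x
    rw [hd1]
    exact ((mehler_aux_fderiv μ _ _ D D' hDd hc C₁ C₂ h1 h2 x).const_smul (exp (-s))).fderiv
  have hexp : ∀ s : ℝ, exp (-2 * s) = exp (-s) * exp (-s) := fun s => by
    rw [← exp_add]; congr 1; ring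
  let g : ℝ → ℝ := fun s =>
    exp (-2 * s) * ∫ y, (∫ v, D' (exp (-s) • u + √(1 - exp (-2 * s)) • v) ∂μ) y y ∂μ
        - exp (-s) * (∫ v, D (exp (-s) • u + √(1 - exp (-2 * s)) • v) ∂μ) u
  have hgen : ∀ s, (∑' n, iteratedFDeriv ℝ 2 (P s F) u ![S (e n), e n])
            - fderiv ℝ (P s F) u u = g s := by
    intro s
    simp only [iteratedFDeriv_two_apply, Matrix.cons_val_zero, Matrix.cons_val_one]
    rw [mehler_aux_trace μ S hS e, hd2, hd1]
    simp only [smul_apply, smul_eq_mul, g]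
    rw [integral_const_mul, integral_const_mul]
    congr 1
    rw [hexp]; ring
  have hAn : ∀ s, ‖∫ v, D' (exp (-s) • u + √(1 - exp (-2 * s)) • v) ∂μ‖ ≤ C₂ := fun s => by
    have := norm_integral_le_of_norm_le_const (μ := μ)
      (f := fun v => D' (exp (-s) • u + √(1 - exp (-2 * s)) • v))
      (Filter.Eventually.of_forall fun v => h2 _)
    simpa using this
  have hA := mehler_aux_cont μ D' hc C₂ h2 u
  have hgc : Continuous g := by
    have c1 := mehler_aux_cont μ D hDc1.continuous C₁ h1 u
    have c2 : Continuous fun s : ℝ =>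
        ∫ y, (∫ v, D' (exp (-s) • u + √(1 - exp (-2 * s)) • v) ∂μ) y y ∂μ := by
      refine continuous_of_dominated (bound := fun y => C₂ * ‖y‖ ^ 2) ?_ ?_ (i2.const_mul _) ?_
      · intro s; exact Continuous.aestronglyMeasurable (by fun_prop)
      · refine fun s => Filter.Eventually.of_forall fun y => ?_
        refine (ContinuousLinearMap.le_opNorm₂ _ _ _).trans ?_
        rw [mul_assoc, ← sq]
        exact mul_le_mul_of_nonneg_right (hAn s) (by positivity)
      · exact Filter.Eventually.of_forall fun y =>
          (hA.clm_apply continuous_const).clm_apply continuous_const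
    exact ((by fun_prop : Continuous fun s : ℝ => exp (-2 * s)).mul c2).sub
      ((by fun_prop : Continuous fun s : ℝ => exp (-s)).mul (c1.clm_apply continuous_const))
  simp_rw [hgen]
  have hftc := intervalIntegral.integral_eq_sub_of_hasDerivAt_of_le ht
    (mehler_aux_cont μ F hF.continuous C₀ h0 u).continuousOn
    (fun s hs => mehler_aux_time μ hμ F D D' hFd hDd hc C₀ C₁ C₂ h0 h1 h2 u s hs.1)
    (hgc.intervalIntegrable 0 t)
  rw [hftc, hP]
  simp
end

section
/- Let μ be a centered Gaussian probability measure on a separable real Hilbert space H with covariance operator S (so ⟨S x, y⟩ = ∫_H ⟨x,v⟩⟨y,v⟩ dμ(v)), let (e_n) be a Hilbert basis of H, and let ν be a probability measure on H with ∫_H ‖u‖ dν(u) < ∞. Then for every F : H → ℝ twice continuously Fréchet differentiable with F, ∇F, ∇²F bounded, the Stein representation formula holds: ∫_H F dμ − ∫_H F dν = ∫_H ∫_0^∞ [ ∑_n ∇²(P_t F)(u)(S e_n, e_n) − (∇(P_t F)(u))(u) ] dt dν(u). -/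
open MeasureTheory Real ProbabilityTheory
open scoped RealInnerProductSpace

section SteinAux
set_option maxSynthPendingDepth 3
set_option linter.unusedSectionVars false
open Filter Topology

variable {H : Type*} [NormedAddCommGroup H] [InnerProductSpace ℝ H] [CompleteSpace H]
    [SecondCountableTopology H] [MeasurableSpace H] [BorelSpace H]

lemma stein_isGaussian (μ : Measure H) [IsProbabilityMeasure μ]
    (hgauss : ∀ ℓ : H →L[ℝ] ℝ, ∃ v : NNReal, Measure.map ℓ μ = gaussianReal 0 v) :
    IsGaussian μ ∧ ∀ L : H →L[ℝ] ℝ, ∫ x, L x ∂μ = 0 := by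
  have h0 : ∀ L : H →L[ℝ] ℝ, ∫ x, L x ∂μ = 0 := by
    intro L
    obtain ⟨v, hv⟩ := hgauss L
    have : ∫ x, x ∂(Measure.map L μ) = ∫ x, L x ∂μ :=
      integral_map (by fun_prop) (by fun_prop)
    rw [← this, hv, integral_id_gaussianReal]
  refine ⟨⟨fun L => ?_⟩, h0⟩
  obtain ⟨v, hv⟩ := hgauss L
  have hvar : Var[L; μ] = v := by
    have : Var[id; Measure.map L μ] = Var[id ∘ L; μ] :=
      variance_map (by fun_prop) (by fun_prop)
    rw [hv, variance_id_gaussianReal] at this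
    simpa using this.symm
  have := h0 L
  rw [hvar, hv, this, Real.toNNReal_coe]

lemma stein_trace (μ : Measure H) [IsProbabilityMeasure μ]
    (h2 : Integrable (fun v : H => ‖v‖ ^ 2) μ)
    (S : H →L[ℝ] H)
    (hS : ∀ x y : H, ⟪S x, y⟫ = ∫ v, ⟪x, v⟫ * ⟪y, v⟫ ∂μ)
    (e : HilbertBasis ℕ ℝ H) (B : H →L[ℝ] H →L[ℝ] ℝ) :
    HasSum (fun n => B (S (e n)) (e n)) (∫ v, B v v ∂μ) := by
  have hpar : ∀ x : H, HasSum (fun n => ⟪e n, x⟫ ^ 2) (‖x‖ ^ 2) := by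
    intro x
    have := e.hasSum_inner_mul_inner x x
    rw [real_inner_self_eq_norm_sq] at this
    refine this.congr_fun ?_ |> id
    intro n
    rw [real_inner_comm x, sq]
  have hB : ∀ v : H, HasSum (fun n => (B v (e n)) ^ 2) (‖B v‖ ^ 2) := by
    intro v
    have := hpar ((InnerProductSpace.toDual ℝ H).symm (B v))
    have h3 : ∀ n, ⟪e n, (InnerProductSpace.toDual ℝ H).symm (B v)⟫ = B v (e n) := by
      intro n
      rw [real_inner_comm, InnerProductSpace.toDual_symm_apply]
    simpa only [h3, LinearIsometryEquiv.norm_map] using this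
  have key : ∀ n, B (S (e n)) (e n) = ∫ v, ⟪e n, v⟫ * B v (e n) ∂μ := by
    intro n
    set b := (InnerProductSpace.toDual ℝ H).symm (B.flip (e n)) with hb
    have h1 : ∀ x, ⟪b, x⟫ = B x (e n) := by
      intro x; rw [hb, InnerProductSpace.toDual_symm_apply]; rfl
    rw [← h1, real_inner_comm, hS]
    simp_rw [h1]
  simp_rw [key]
  refine hasSum_integral_of_dominated_convergence
    (fun n v => ⟪e n, v⟫ ^ 2 + (B v (e n)) ^ 2) ?_ ?_ ?_ ?_ ?_
  · intro n
    exact Continuous.aestronglyMeasurable (by fun_prop)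
  · intro n
    refine Eventually.of_forall fun v => ?_
    rw [Real.norm_eq_abs, abs_le]
    constructor <;> nlinarith [sq_nonneg (⟪e n, v⟫ + B v (e n)), sq_nonneg (⟪e n, v⟫ - B v (e n)), sq_nonneg (⟪e n, v⟫), sq_nonneg (B v (e n))]
  · exact Eventually.of_forall fun v => ((hpar v).add (hB v)).summable
  · have : (fun v => ∑' n, (⟪e n, v⟫ ^ 2 + (B v (e n)) ^ 2)) = fun v => ‖v‖ ^ 2 + ‖B v‖ ^ 2 := by
      ext v; exact ((hpar v).add (hB v)).tsum_eq
    rw [this]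
    refine h2.add ?_
    refine (h2.const_mul (‖B‖ ^ 2)).mono' (Continuous.aestronglyMeasurable (by fun_prop)) ?_
    refine Eventually.of_forall fun v => ?_
    rw [Real.norm_eq_abs, abs_of_nonneg (by positivity), ← mul_pow]
    gcongr
    exact B.le_opNorm v
  · refine Eventually.of_forall fun v => ?_
    have := (e.hasSum_repr v).mapL (B v)
    simpa [e.repr_apply_apply] using this

lemma stein_fderiv {E : Type*} [NormedAddCommGroup E] [NormedSpace ℝ E] [CompleteSpace E]
    (μ : Measure H) [IsProbabilityMeasure μ] (G : H → E) (hG : ContDiff ℝ 1 G) (C D : ℝ)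
    (hC : ∀ u, ‖G u‖ ≤ C) (hD : ∀ u, ‖fderiv ℝ G u‖ ≤ D) (a s : ℝ) (u : H) :
    HasFDerivAt (fun u => ∫ v, G (a • u + s • v) ∂μ)
      (a • ∫ v, fderiv ℝ G (a • u + s • v) ∂μ) u := by
  have hc := hG.continuous
  have hc' : Continuous (fderiv ℝ G) := hG.continuous_fderiv (by norm_num)
  rw [← integral_smul]
  refine hasFDerivAt_integral_of_dominated_of_fderiv_le
    (F' := fun u v => a • fderiv ℝ G (a • u + s • v)) (bound := fun _ => |a| * D)
    (s := Set.univ) univ_mem ?_ ?_ ?_ ?_ ?_ ?_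
  · exact Eventually.of_forall fun x => Continuous.aestronglyMeasurable (by fun_prop)
  · exact (integrable_const C).mono' (Continuous.aestronglyMeasurable (by fun_prop))
      (Eventually.of_forall fun x => hC _)
  · exact Continuous.aestronglyMeasurable (by fun_prop)
  · refine Eventually.of_forall fun v x _ => ?_
    rw [norm_smul, Real.norm_eq_abs]
    gcongr
    exact hD _
  · exact integrable_const _
  · refine Eventually.of_forall fun v x _ => ?_
    have h1 : HasFDerivAt (fun x : H => a • x + s • v) (a • ContinuousLinearMap.id ℝ H) x :=
      ((hasFDerivAt_id x).const_smul a).add_const _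
    have h2 := ((hG.differentiable (by norm_num)) (a • x + s • v)).hasFDerivAt.comp x h1
    refine h2.congr_fderiv ?_
    refine ContinuousLinearMap.ext fun y => ?_
    simp

lemma stein_ibp (μ : Measure H) [IsProbabilityMeasure μ]
    (h1 : Integrable (fun v : H => ‖v‖) μ) (h2 : Integrable (fun v : H => ‖v‖ ^ 2) μ)
    (hrot : ∀ θ, (μ.prod μ).map (ContinuousLinearMap.rotation (E := H) θ) = μ.prod μ)
    (G : H → H →L[ℝ] ℝ) (hG : ContDiff ℝ 1 G) (C D : ℝ)
    (hC : ∀ u, ‖G u‖ ≤ C) (hD : ∀ u, ‖fderiv ℝ G u‖ ≤ D) :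
    ∫ w, G w w ∂μ = ∫ v, (∫ w, fderiv ℝ G w ∂μ) v v ∂μ := by
  have hc := hG.continuous
  have hc' : Continuous (fderiv ℝ G) := hG.continuous_fderiv (by norm_num)
  have hC0 : 0 ≤ C := (norm_nonneg _).trans (hC 0)
  have hD0 : 0 ≤ D := le_trans (norm_nonneg (fderiv ℝ G 0)) (hD 0)
  have i1 : Integrable (fun p : H × H => ‖p.1‖) (μ.prod μ) := h1.comp_fst μ
  have i2 : Integrable (fun p : H × H => ‖p.2‖) (μ.prod μ) := h1.comp_snd μ
  have j1 : Integrable (fun p : H × H => ‖p.1‖ ^ 2) (μ.prod μ) := h2.comp_fst μ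
  have j2 : Integrable (fun p : H × H => ‖p.2‖ ^ 2) (μ.prod μ) := h2.comp_snd μ
  -- the rotated integrals are constant
  have hconst : ∀ θ : ℝ, ∫ p : H × H, G (cos θ • p.1 + sin θ • p.2)
      (-sin θ • p.1 + cos θ • p.2) ∂(μ.prod μ) = ∫ p : H × H, G p.1 p.2 ∂(μ.prod μ) := by
    intro θ
    conv_rhs => rw [← hrot θ]
    rw [integral_map (by fun_prop) (Continuous.aestronglyMeasurable (by fun_prop))]
    simp [ContinuousLinearMap.rotation_apply]
  have hder := (hasDerivAt_integral_of_dominated_loc_of_deriv_le (μ := μ.prod μ)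
    (F := fun θ (p : H × H) => G (cos θ • p.1 + sin θ • p.2) (-sin θ • p.1 + cos θ • p.2))
    (F' := fun θ (p : H × H) =>
      fderiv ℝ G (cos θ • p.1 + sin θ • p.2) (-sin θ • p.1 + cos θ • p.2)
        (-sin θ • p.1 + cos θ • p.2) +
      G (cos θ • p.1 + sin θ • p.2) (-cos θ • p.1 + -sin θ • p.2))
    (bound := fun p => D * (2 * (‖p.1‖ ^ 2 + ‖p.2‖ ^ 2)) + C * (‖p.1‖ + ‖p.2‖))
    (s := Set.univ) (x₀ := (0:ℝ)) univ_mem ?_ ?_ ?_ ?_ ?_ ?_).2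
  · simp_rw [hconst] at hder
    have h0 := hder.unique (hasDerivAt_const _ _)
    simp only [cos_zero, sin_zero, one_smul, zero_smul, add_zero, neg_zero, zero_add, neg_smul]
      at h0
    have k1 : Integrable (fun p : H × H => fderiv ℝ G p.1 p.2 p.2) (μ.prod μ) := by
      refine (j2.const_mul D).mono' (Continuous.aestronglyMeasurable (by fun_prop)) ?_
      refine Eventually.of_forall fun p => ?_
      calc _ ≤ ‖fderiv ℝ G p.1‖ * ‖p.2‖ * ‖p.2‖ := ContinuousLinearMap.le_opNorm₂ _ _ _
        _ ≤ D * ‖p.2‖ * ‖p.2‖ := by gcongr; exact hD _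
        _ = _ := by ring
    have k2 : Integrable (fun p : H × H => G p.1 (-p.1)) (μ.prod μ) := by
      refine (i1.const_mul C).mono' (Continuous.aestronglyMeasurable (by fun_prop)) ?_
      refine Eventually.of_forall fun p => ?_
      refine (ContinuousLinearMap.le_opNorm _ _).trans ?_
      rw [norm_neg]; gcongr; exact hC _
    rw [integral_add k1 k2, integral_prod_symm _ k1, integral_prod _ k2] at h0
    simp only [map_neg, integral_neg, integral_const, probReal_univ, smul_eq_mul, one_mul] at h0
    have hi : Integrable (fderiv ℝ G) μ := (integrable_const D).mono'
      (Continuous.aestronglyMeasurable (by fun_prop)) (Eventually.of_forall hD)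
    have e1 : ∀ v, (∫ w, fderiv ℝ G w ∂μ) v v = ∫ w, fderiv ℝ G w v v ∂μ := by
      intro v
      rw [ContinuousLinearMap.integral_apply hi, ContinuousLinearMap.integral_apply]
      exact hi.apply_continuousLinearMap v
    simp_rw [e1]
    linarith
  · exact Eventually.of_forall fun x => Continuous.aestronglyMeasurable (by fun_prop)
  · simp only [cos_zero, sin_zero, one_smul, zero_smul, add_zero, neg_zero, zero_add]
    refine (i2.const_mul C).mono' (Continuous.aestronglyMeasurable (by fun_prop)) ?_
    refine Eventually.of_forall fun p => ?_
    refine (ContinuousLinearMap.le_opNorm _ _).trans ?_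
    gcongr; exact hC _
  · exact Continuous.aestronglyMeasurable (by fun_prop)
  · refine Eventually.of_forall fun p θ _ => ?_
    have n1 : ∀ a b : ℝ, |a| ≤ 1 → |b| ≤ 1 → ‖a • p.1 + b • p.2‖ ≤ ‖p.1‖ + ‖p.2‖ := by
      intro a b ha hb
      refine (norm_add_le _ _).trans ?_
      rw [norm_smul, norm_smul, Real.norm_eq_abs, Real.norm_eq_abs]
      nlinarith [norm_nonneg p.1, norm_nonneg p.2]
    have m1 := n1 (-sin θ) (cos θ) (by rw [abs_neg]; exact abs_sin_le_one θ) (abs_cos_le_one θ)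
    have m2 := n1 (-cos θ) (-sin θ) (by rw [abs_neg]; exact abs_cos_le_one θ)
      (by rw [abs_neg]; exact abs_sin_le_one θ)
    refine (norm_add_le _ _).trans (add_le_add ?_ ?_)
    · refine (ContinuousLinearMap.le_opNorm₂ _ _ _).trans ?_
      rw [mul_assoc]
      refine mul_le_mul (hD _) ?_ (by positivity) hD0
      nlinarith [norm_nonneg (-sin θ • p.1 + cos θ • p.2), sq_nonneg (‖p.1‖ - ‖p.2‖)]
    · refine (ContinuousLinearMap.le_opNorm _ _).trans ?_
      exact mul_le_mul (hC _) m2 (by positivity) hC0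
  · exact ((j1.add j2).const_mul 2 |>.const_mul D).add ((i1.add i2).const_mul C)
  · refine Eventually.of_forall fun p θ _ => ?_
    have hx : HasDerivAt (fun θ : ℝ => cos θ • p.1 + sin θ • p.2)
        (-sin θ • p.1 + cos θ • p.2) θ :=
      ((hasDerivAt_cos θ).smul_const _).add ((hasDerivAt_sin θ).smul_const _)
    have hy : HasDerivAt (fun θ : ℝ => -sin θ • p.1 + cos θ • p.2)
        (-cos θ • p.1 + -sin θ • p.2) θ :=
      ((hasDerivAt_sin θ).neg.smul_const _).add ((hasDerivAt_cos θ).smul_const _)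
    have hg := ((hG.differentiable (by norm_num))
      (cos θ • p.1 + sin θ • p.2)).hasFDerivAt.comp_hasDerivAt θ hx
    exact hg.clm_apply hy


lemma stein_time_deriv (μ : Measure H) [IsProbabilityMeasure μ]
    (h1 : Integrable (fun v : H => ‖v‖) μ)
    (F : H → ℝ) (hF : ContDiff ℝ 1 F) (C D : ℝ)
    (hC : ∀ u, ‖F u‖ ≤ C) (hD : ∀ u, ‖fderiv ℝ F u‖ ≤ D) (u : H) (t : ℝ) (ht : 0 < t) :
    HasDerivAt (fun t => ∫ v, F (exp (-t) • u + √(1 - exp (-2 * t)) • v) ∂μ)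
      (exp (-2 * t) / √(1 - exp (-2 * t)) *
          ∫ v, fderiv ℝ F (exp (-t) • u + √(1 - exp (-2 * t)) • v) v ∂μ
        - exp (-t) * (∫ v, fderiv ℝ F (exp (-t) • u + √(1 - exp (-2 * t)) • v) ∂μ) u) t := by
  have hc := hF.continuous
  have hc' : Continuous (fderiv ℝ F) := hF.continuous_fderiv (by norm_num)
  have hD0 : 0 ≤ D := le_trans (norm_nonneg (fderiv ℝ F 0)) (hD 0)
  have hpos : ∀ r : ℝ, 0 < r → 0 < 1 - exp (-2 * r) := by
    intro r hr
    have : exp (-2 * r) < 1 := by rw [exp_lt_one_iff]; linarith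
    linarith
  have hder := (hasDerivAt_integral_of_dominated_loc_of_deriv_le (μ := μ)
    (F := fun t v => F (exp (-t) • u + √(1 - exp (-2 * t)) • v))
    (F' := fun t v => fderiv ℝ F (exp (-t) • u + √(1 - exp (-2 * t)) • v)
      ((-exp (-t)) • u + (exp (-2 * t) / √(1 - exp (-2 * t))) • v))
    (bound := fun v => D * (‖u‖ + (1 / √(1 - exp (-2 * (t / 2)))) * ‖v‖))
    (s := Set.Ioi (t / 2)) (x₀ := t) (Ioi_mem_nhds (by linarith)) ?_ ?_ ?_ ?_ ?_ ?_).2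
  · refine hder.congr_deriv ?_
    have i1 : Integrable (fun v => fderiv ℝ F (exp (-t) • u + √(1 - exp (-2 * t)) • v)) μ :=
      (integrable_const D).mono' (Continuous.aestronglyMeasurable (by fun_prop))
        (Eventually.of_forall fun v => hD _)
    have i2 : Integrable (fun v => fderiv ℝ F (exp (-t) • u + √(1 - exp (-2 * t)) • v) v) μ := by
      refine (h1.const_mul D).mono' (Continuous.aestronglyMeasurable (by fun_prop)) ?_
      refine Eventually.of_forall fun v => ?_
      refine (ContinuousLinearMap.le_opNorm _ _).trans ?_
      gcongr; exact hD _
    simp only [map_add, map_smul, smul_eq_mul]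
    rw [integral_add ((i1.apply_continuousLinearMap u).const_mul _) (i2.const_mul _),
      integral_const_mul, integral_const_mul, ContinuousLinearMap.integral_apply i1]
    ring
  · exact Eventually.of_forall fun x => Continuous.aestronglyMeasurable (by fun_prop)
  · exact (integrable_const C).mono' (Continuous.aestronglyMeasurable (by fun_prop))
      (Eventually.of_forall fun x => hC _)
  · exact Continuous.aestronglyMeasurable (by fun_prop)
  · refine Eventually.of_forall fun v r hr => ?_
    have hr' : t / 2 < r := hr
    have hr0 : 0 < r := by linarith
    refine (ContinuousLinearMap.le_opNorm _ _).trans ?_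
    refine mul_le_mul (hD _) ?_ (by positivity) hD0
    refine (norm_add_le _ _).trans ?_
    rw [norm_smul, norm_smul, Real.norm_eq_abs, Real.norm_eq_abs, abs_neg, abs_of_pos (exp_pos _),
      abs_of_nonneg (by positivity)]
    have e1 : exp (-r) ≤ 1 := by rw [exp_le_one_iff]; linarith
    have e2 : exp (-2 * r) ≤ 1 := by rw [exp_le_one_iff]; linarith
    have e3 : exp (-2 * r) ≤ exp (-2 * (t / 2)) := by rw [exp_le_exp]; linarith
    have e4 := hpos (t / 2) (by linarith)
    have e5 : 0 < √(1 - exp (-2 * (t / 2))) := Real.sqrt_pos.2 e4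
    have e6 : √(1 - exp (-2 * (t / 2))) ≤ √(1 - exp (-2 * r)) := Real.sqrt_le_sqrt (by linarith)
    refine add_le_add ?_ ?_
    · nlinarith [norm_nonneg u]
    · gcongr
  · exact ((integrable_const _).add (h1.const_mul _)).const_mul D
  · refine Eventually.of_forall fun v r hr => ?_
    have hr' : t / 2 < r := hr
    have hr0 : 0 < r := by linarith
    have d1 : HasDerivAt (fun r : ℝ => exp (-r)) (-exp (-r)) r := by
      simpa using (hasDerivAt_neg r).exp
    have d2 : HasDerivAt (fun r : ℝ => √(1 - exp (-2 * r)))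
        (exp (-2 * r) / √(1 - exp (-2 * r))) r := by
      have d3 : HasDerivAt (fun r : ℝ => 1 - exp (-2 * r)) (-(exp (-2 * r) * (-2 * 1))) r :=
        (((hasDerivAt_id r).const_mul (-2 : ℝ)).exp).const_sub 1
      have d4 := d3.sqrt (hpos r hr0).ne'
      convert d4 using 1
      have := (Real.sqrt_pos.2 (hpos r hr0)).ne'
      field_simp
    exact ((hF.differentiable (by norm_num)) _).hasFDerivAt.comp_hasDerivAt r
      ((d1.smul_const u).add (d2.smul_const v))

lemma stein_core (μ : Measure H) [IsProbabilityMeasure μ]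
    (hgauss : ∀ ℓ : H →L[ℝ] ℝ, ∃ v : NNReal, Measure.map ℓ μ = gaussianReal 0 v)
    (S : H →L[ℝ] H)
    (hS : ∀ x y : H, ⟪S x, y⟫ = ∫ v, ⟪x, v⟫ * ⟪y, v⟫ ∂μ)
    (e : HilbertBasis ℕ ℝ H)
    (F : H → ℝ) (hF : ContDiff ℝ 2 F) (C D K : ℝ)
    (hC : ∀ u, ‖F u‖ ≤ C) (hD : ∀ u, ‖fderiv ℝ F u‖ ≤ D)
    (hK : ∀ u, ‖fderiv ℝ (fderiv ℝ F) u‖ ≤ K)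
    (P : ℝ → (H → ℝ) → H → ℝ)
    (hP : ∀ t G u, P t G u
      = ∫ v, G (Real.exp (-t) • u + Real.sqrt (1 - Real.exp (-2 * t)) • v) ∂μ) (u : H) :
    (∫ t in Set.Ioi (0:ℝ), ((∑' n, iteratedFDeriv ℝ 2 (P t F) u ![S (e n), e n])
            - fderiv ℝ (P t F) u u)) = (∫ u, F u ∂μ) - F u := by
  obtain ⟨hG, h0⟩ := stein_isGaussian μ hgauss
  have h1 : Integrable (fun v : H => ‖v‖) μ := (IsGaussian.integrable_id (μ := μ)).norm
  have h2 : Integrable (fun v : H => ‖v‖ ^ 2) μ := by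
    simpa using (IsGaussian.memLp_two_id (μ := μ)).integrable_norm_pow (by norm_num)
  have hrot := IsGaussian.map_rotation_eq_self_of_forall_strongDual_eq_zero (μ := μ) h0
  have hF1 : ContDiff ℝ 1 F := hF.of_le (by norm_num)
  have hF' : ContDiff ℝ 1 (fderiv ℝ F) := hF.fderiv_right (by norm_num)
  have hc := hF.continuous
  have hc' := hF'.continuous
  have hc'' : Continuous (fderiv ℝ (fderiv ℝ F)) := hF'.continuous_fderiv (by norm_num)
  have hD0 : 0 ≤ D := le_trans (norm_nonneg (fderiv ℝ F 0)) (hD 0)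
  have hK0 : 0 ≤ K := le_trans (norm_nonneg (fderiv ℝ (fderiv ℝ F) 0)) (hK 0)
  have hPF : ∀ t, P t F = fun u => ∫ v, F (exp (-t) • u + √(1 - exp (-2 * t)) • v) ∂μ :=
    fun t => funext fun u => hP t F u
  have hfd : ∀ t, fderiv ℝ (P t F) = fun u =>
      exp (-t) • ∫ v, fderiv ℝ F (exp (-t) • u + √(1 - exp (-2 * t)) • v) ∂μ := by
    intro t
    rw [hPF]
    exact funext fun u => (stein_fderiv μ F hF1 C D hC hD _ _ u).fderiv
  have hfd2 : ∀ t u, fderiv ℝ (fderiv ℝ (P t F)) u =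
      exp (-t) • exp (-t) • ∫ v, fderiv ℝ (fderiv ℝ F)
        (exp (-t) • u + √(1 - exp (-2 * t)) • v) ∂μ := by
    intro t u
    rw [hfd]
    exact ((stein_fderiv μ (fderiv ℝ F) hF' D K hD hK _ _ u).const_smul (exp (-t))).fderiv
  -- value of the generator
  have hL : ∀ t, ((∑' n, iteratedFDeriv ℝ 2 (P t F) u ![S (e n), e n])
            - fderiv ℝ (P t F) u u) = exp (-2 * t) * (∫ w, (∫ v, fderiv ℝ (fderiv ℝ F)
        (exp (-t) • u + √(1 - exp (-2 * t)) • v) ∂μ) w w ∂μ) -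
        exp (-t) * (∫ v, fderiv ℝ F (exp (-t) • u + √(1 - exp (-2 * t)) • v) ∂μ) u := by
    intro t
    congr 1
    · simp only [iteratedFDeriv_two_apply, Matrix.cons_val_zero, Matrix.cons_val_one]
      rw [(stein_trace μ h2 S hS e _).tsum_eq, hfd2, ← integral_const_mul]
      congr 1
      ext w
      have : exp (-2 * t) = exp (-t) * exp (-t) := by rw [← exp_add]; congr 1; ring
      rw [this]
      simp [mul_assoc]
    · rw [hfd]; simp
  have hderiv : ∀ t ∈ Set.Ioi (0:ℝ), HasDerivAt (fun t => P t F u)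
      ((∑' n, iteratedFDeriv ℝ 2 (P t F) u ![S (e n), e n]) - fderiv ℝ (P t F) u u) t := by
    intro t ht
    have ht0 : (0:ℝ) < t := ht
    rw [hL]
    simp_rw [hP]
    convert stein_time_deriv μ h1 F hF1 C D hC hD u t ht using 2
    have hs : 0 < √(1 - exp (-2 * t)) := by
      apply Real.sqrt_pos.2
      have : exp (-2 * t) < 1 := by rw [exp_lt_one_iff]; linarith
      linarith
    set s := √(1 - exp (-2 * t)) with hsdef
    set x := exp (-t) • u with hx
    have hfdx : ∀ v, fderiv ℝ (fun v => fderiv ℝ F (x + s • v)) v =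
        s • fderiv ℝ (fderiv ℝ F) (x + s • v) := by
      intro v
      have g1 : HasFDerivAt (fun v : H => x + s • v) (s • ContinuousLinearMap.id ℝ H) v :=
        ((hasFDerivAt_id v).const_smul s).const_add _
      have g2 := ((hF'.differentiable (by norm_num)) (x + s • v)).hasFDerivAt.comp v g1
      refine g2.fderiv.trans ?_
      refine ContinuousLinearMap.ext fun y => ?_
      simp
    have hibp := stein_ibp μ h1 h2 hrot (fun v => fderiv ℝ F (x + s • v))
      (hF'.comp (by fun_prop)) D (s * K) (fun v => hD _) (fun v => by
        rw [hfdx, norm_smul, Real.norm_eq_abs, abs_of_pos hs]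
        gcongr
        exact hK _)
    rw [hibp]
    simp_rw [hfdx]
    rw [integral_smul]
    simp only [smul_apply, smul_eq_mul]
    rw [integral_const_mul]
    field_simp
  have hbound : ∀ t, ‖(∑' n, iteratedFDeriv ℝ 2 (P t F) u ![S (e n), e n])
      - fderiv ℝ (P t F) u u‖ ≤ exp (-2 * t) * (K * ∫ w : H, ‖w‖ ^ 2 ∂μ) +
        exp (-1 * t) * (D * ‖u‖) := by
    intro t
    rw [hL]
    refine (norm_sub_le _ _).trans (add_le_add ?_ ?_)
    · rw [norm_mul, Real.norm_eq_abs, abs_of_pos (exp_pos _)]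
      gcongr
      rw [← integral_const_mul]
      refine norm_integral_le_of_norm_le (h2.const_mul K) (Eventually.of_forall fun w => ?_)
      refine (ContinuousLinearMap.le_opNorm₂ _ _ _).trans ?_
      rw [mul_assoc, ← sq]
      gcongr
      simpa using norm_integral_le_of_norm_le (integrable_const (μ := μ) K)
        (Eventually.of_forall fun v => hK (exp (-t) • u + √(1 - exp (-2 * t)) • v))
    · rw [norm_mul, Real.norm_eq_abs, abs_of_pos (exp_pos _), neg_one_mul]
      gcongr
      refine (ContinuousLinearMap.le_opNorm _ _).trans ?_
      gcongr
      simpa using norm_integral_le_of_norm_le (integrable_const (μ := μ) D)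
        (Eventually.of_forall fun v => hD (exp (-t) • u + √(1 - exp (-2 * t)) • v))
  have hint : IntegrableOn (fun t => (∑' n, iteratedFDeriv ℝ 2 (P t F) u ![S (e n), e n])
      - fderiv ℝ (P t F) u u) (Set.Ioi (0:ℝ)) := by
    have hb : IntegrableOn (fun t => exp (-2 * t) * (K * ∫ w : H, ‖w‖ ^ 2 ∂μ) +
        exp (-1 * t) * (D * ‖u‖)) (Set.Ioi (0:ℝ)) := by
      refine Integrable.add ?_ ?_
      · exact (integrableOn_exp_mul_Ioi (by norm_num) 0).mul_const _
      · exact (integrableOn_exp_mul_Ioi (by norm_num) 0).mul_const _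
    refine Integrable.mono' hb ?_ (Eventually.of_forall hbound)
    refine (measurable_deriv (fun t => P t F u)).aestronglyMeasurable.congr ?_
    filter_upwards [ae_restrict_mem measurableSet_Ioi] with t ht
    exact (hderiv t ht).deriv
  have hcont : Continuous (fun t => P t F u) := by
    simp_rw [hP]
    refine continuous_of_dominated (bound := fun _ => C) ?_ ?_ (integrable_const C) ?_
    · exact fun t => Continuous.aestronglyMeasurable (by fun_prop)
    · exact fun t => Eventually.of_forall fun v => hC _
    · exact Eventually.of_forall fun v => by fun_prop
  have hlim : Tendsto (fun t => P t F u) atTop (𝓝 (∫ v, F v ∂μ)) := by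
    simp_rw [hP]
    refine tendsto_integral_filter_of_dominated_convergence (fun _ => C) ?_ ?_
      (integrable_const C) ?_
    · exact Eventually.of_forall fun t => Continuous.aestronglyMeasurable (by fun_prop)
    · exact Eventually.of_forall fun t => Eventually.of_forall fun v => hC _
    · refine Eventually.of_forall fun v => ?_
      have l1 : Tendsto (fun t : ℝ => exp (-t)) atTop (𝓝 0) :=
        Real.tendsto_exp_neg_atTop_nhds_zero
      have l2 : Tendsto (fun t : ℝ => exp (-2 * t)) atTop (𝓝 0) := by
        have := l1.comp (tendsto_id.const_mul_atTop (by norm_num : (0:ℝ) < 2))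
        refine this.congr fun t => ?_
        simp
      have l3 : Tendsto (fun t : ℝ => √(1 - exp (-2 * t))) atTop (𝓝 1) := by
        simpa using (tendsto_const_nhds.sub l2 : Tendsto (fun t : ℝ => 1 - exp (-2 * t)) atTop
          (𝓝 (1 - 0))).sqrt
      have l4 : Tendsto (fun t : ℝ => exp (-t) • u + √(1 - exp (-2 * t)) • v) atTop (𝓝 v) := by
        simpa using (l1.smul_const u).add (l3.smul_const v)
      exact (hc.tendsto v).comp l4
  rw [integral_Ioi_of_hasDerivAt_of_tendsto hcont.continuousWithinAt hderiv hint hlim]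
  simp [hP]

end SteinAux

/-- Stein representation formula on a separable Hilbert space: for a centered Gaussian
measure `μ` with covariance operator `S`, a probability measure `ν` with finite first
moment, and `F : H → ℝ` of class `C²` with `F, ∇F, ∇²F` bounded,
`∫ F dμ − ∫ F dν = ∫ ∫₀^∞ [ ∑_n ∇²(P_t F)(u)(S e_n, e_n) − ∇(P_t F)(u)(u) ] dt dν(u)`. -/
theorem stein_representation_formula
    {H : Type*} [NormedAddCommGroup H] [InnerProductSpace ℝ H] [CompleteSpace H]
    [TopologicalSpace.SeparableSpace H] [MeasurableSpace H] [BorelSpace H]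
    (μ : Measure H) [IsProbabilityMeasure μ]
    (hgauss : ∀ ℓ : H →L[ℝ] ℝ, ∃ v : NNReal, Measure.map ℓ μ = gaussianReal 0 v)
    (S : H →L[ℝ] H)
    (hS : ∀ x y : H, ⟪S x, y⟫ = ∫ v, ⟪x, v⟫ * ⟪y, v⟫ ∂μ)
    (e : HilbertBasis ℕ ℝ H)
    (ν : Measure H) [IsProbabilityMeasure ν]
    (hν : Integrable (fun u => ‖u‖) ν)
    (F : H → ℝ) (hF : ContDiff ℝ 2 F)
    (hFb : ∀ i ≤ 2, ∃ C, ∀ u, ‖iteratedFDeriv ℝ i F u‖ ≤ C)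
    (P : ℝ → (H → ℝ) → H → ℝ)
    (hP : ∀ t G u, P t G u
      = ∫ v, G (Real.exp (-t) • u + Real.sqrt (1 - Real.exp (-2 * t)) • v) ∂μ) :
    (∫ u, F u ∂μ) - ∫ u, F u ∂ν
      = ∫ u, (∫ t in Set.Ioi (0:ℝ),
          ((∑' n, iteratedFDeriv ℝ 2 (P t F) u ![S (e n), e n])
            - fderiv ℝ (P t F) u u)) ∂ν := by
  have : SecondCountableTopology H := UniformSpace.secondCountable_of_separable H
  obtain ⟨C, hC⟩ := hFb 0 (by norm_num)
  obtain ⟨D, hD⟩ := hFb 1 (by norm_num)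
  obtain ⟨K, hK⟩ := hFb 2 le_rfl
  have hC' : ∀ u, ‖F u‖ ≤ C := fun u => by simpa using hC u
  have hD' : ∀ u, ‖fderiv ℝ F u‖ ≤ D := fun u => by
    rw [← norm_iteratedFDeriv_one]; exact hD u
  have hK' : ∀ u, ‖fderiv ℝ (fderiv ℝ F) u‖ ≤ K := fun u => by
    rw [← norm_iteratedFDeriv_one, norm_iteratedFDeriv_fderiv]; exact hK u
  have hi : Integrable F ν := (integrable_const C).mono'
    hF.continuous.aestronglyMeasurable (Filter.Eventually.of_forall hC')
  simp_rw [stein_core μ hgauss S hS e F hF C D K hC' hD' hK' P hP]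
  rw [integral_sub (integrable_const _) hi]
  simp
end

section
/- Let λ > 0, let X_λ be a random variable with the Poisson distribution of parameter λ on ℕ, and set X̃_λ = (X_λ − λ)/√λ. Then for every 1-Lipschitz function F : ℝ → ℝ, | E[F(X̃_λ)] − ∫_ℝ F dγ | ≤ 1/√λ, where γ is the standard Gaussian measure N(0,1) on ℝ. In particular the Wasserstein–Rubinstein distance between the law of X̃_λ and N(0,1) is at most 1/√λ. -/
open MeasureTheory Real ProbabilityTheory

noncomputable def gw (t : ℝ) : ℝ := Real.exp (-(1/2) * t ^ 2)

lemma gw_pos (t : ℝ) : 0 < gw t := Real.exp_pos _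

lemma gw_hasDerivAt (t : ℝ) : HasDerivAt gw (-t * gw t) t := by
  have := (((hasDerivAt_id t).pow 2).const_mul (-(1/2) : ℝ)).exp
  unfold gw
  convert! this using 1
  simp
  ring

lemma gw_continuous : Continuous gw := by unfold gw; fun_prop

lemma gw_int0 : Integrable gw := integrable_exp_neg_mul_sq (by norm_num)

lemma gw_int1 : Integrable (fun t => t * gw t) := integrable_mul_exp_neg_mul_sq (by norm_num)

lemma gw_int2 : Integrable (fun t => t ^ 2 * gw t) := by
  have := integrable_rpow_mul_exp_neg_mul_sq (b := 1/2) (by norm_num) (s := 2) (by norm_num)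
  simpa [gw] using this

lemma gw_total : ∫ t, gw t = √(2 * π) := by
  unfold gw
  rw [integral_gaussian]
  congr 1
  ring

lemma gw_tendsto0 : Filter.Tendsto gw (Filter.cocompact ℝ) (nhds 0) := by
  have := tendsto_rpow_abs_mul_exp_neg_mul_sq_cocompact (a := 1/2) (by norm_num) 0
  refine this.congr fun t => ?_
  rw [rpow_zero, one_mul]
  rfl

lemma gw_tendsto1 : Filter.Tendsto (fun t => t * gw t) (Filter.cocompact ℝ) (nhds 0) := by
  have := tendsto_rpow_abs_mul_exp_neg_mul_sq_cocompact (a := 1/2) (by norm_num) 1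
  rw [tendsto_zero_iff_abs_tendsto_zero]
  refine this.congr fun t => ?_
  simp only [Function.comp, abs_mul, rpow_one, abs_of_pos (gw_pos t)]
  rfl

lemma gw_lip_int (F : ℝ → ℝ) (hF : LipschitzWith 1 F) : Integrable (fun t => F t * gw t) := by
  have h : Integrable (fun t => |F 0| * gw t + |t * gw t|) :=
    (gw_int0.const_mul _).add gw_int1.abs
  refine h.mono' (hF.continuous.mul gw_continuous).aestronglyMeasurable
    (Filter.Eventually.of_forall fun t => ?_)
  have h1 := hF.dist_le_mul t 0
  simp only [Real.dist_eq, NNReal.coe_one, one_mul, sub_zero] at h1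
  have h2 : |F t| ≤ |F 0| + |t| := by
    have := abs_sub_abs_le_abs_sub (F t) (F 0)
    linarith
  rw [Real.norm_eq_abs, abs_mul, abs_mul, abs_of_pos (gw_pos t), ← add_mul]
  exact mul_le_mul_of_nonneg_right h2 (gw_pos t).le

lemma gw_Ioi1 (x : ℝ) : ∫ t in Set.Ioi x, t * gw t = gw x := by
  have := integral_Ioi_of_hasDerivAt_of_tendsto' (a := x) (m := -0) (f := fun t => -gw t)
    (f' := fun t => t * gw t)
    (fun t _ => by convert! (gw_hasDerivAt t).neg using 1; ring) gw_int1.integrableOn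
    (gw_tendsto0.mono_left atTop_le_cocompact).neg
  simpa using this

lemma gw_Iic1 (x : ℝ) : ∫ t in Set.Iic x, t * gw t = -gw x := by
  have := integral_Iic_of_hasDerivAt_of_tendsto' (a := x) (m := -0) (f := fun t => -gw t)
    (f' := fun t => t * gw t)
    (fun t _ => by convert! (gw_hasDerivAt t).neg using 1; ring) gw_int1.integrableOn
    (gw_tendsto0.mono_left atBot_le_cocompact).neg
  simpa using this

lemma gw_D2 (t : ℝ) : HasDerivAt (fun t => -(t * gw t)) (t ^ 2 * gw t - gw t) t := by
  convert! ((hasDerivAt_id t).mul (gw_hasDerivAt t)).neg using 1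
  simp; ring

lemma gw_Ioi2 (x : ℝ) : ∫ t in Set.Ioi x, (t ^ 2 * gw t - gw t) = x * gw x := by
  have := integral_Ioi_of_hasDerivAt_of_tendsto' (a := x) (m := -0)
    (fun t _ => gw_D2 t) (gw_int2.sub gw_int0).integrableOn
    (gw_tendsto1.mono_left atTop_le_cocompact).neg
  simpa using this

lemma gw_Iic2 (x : ℝ) : ∫ t in Set.Iic x, (t ^ 2 * gw t - gw t) = -(x * gw x) := by
  have := integral_Iic_of_hasDerivAt_of_tendsto' (a := x) (m := -0)
    (fun t _ => gw_D2 t) (gw_int2.sub gw_int0).integrableOn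
    (gw_tendsto1.mono_left atBot_le_cocompact).neg
  simpa using this

lemma gw_sq (s : Set ℝ) (x : ℝ) :
    0 ≤ (∫ t in s, (t ^ 2 * gw t - gw t)) - 2 * x * (∫ t in s, t * gw t)
      + (1 + x ^ 2) * ∫ t in s, gw t := by
  have h : 0 ≤ ∫ t in s, (t - x) ^ 2 * gw t :=
    integral_nonneg fun t => mul_nonneg (sq_nonneg _) (gw_pos t).le
  have e : ∫ t in s, (t - x) ^ 2 * gw t =
      ∫ t in s, ((t ^ 2 * gw t - gw t) - (2 * x) * (t * gw t)) + (1 + x ^ 2) * gw t := by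
    congr 1; ext t; ring
  rw [e, integral_add, integral_sub, integral_const_mul, integral_const_mul] at h
  · exact h
  · exact (gw_int2.sub gw_int0).integrableOn
  · exact (gw_int1.const_mul _).integrableOn
  · exact ((gw_int2.sub gw_int0).sub (gw_int1.const_mul _)).integrableOn
  · exact (gw_int0.const_mul _).integrableOn

lemma mills_Ioi (x : ℝ) : x * gw x ≤ (1 + x ^ 2) * ∫ t in Set.Ioi x, gw t := by
  have := gw_sq (Set.Ioi x) x
  rw [gw_Ioi2, gw_Ioi1] at this
  linarith

lemma mills_Iic (x : ℝ) : -(x * gw x) ≤ (1 + x ^ 2) * ∫ t in Set.Iic x, gw t := by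
  have := gw_sq (Set.Iic x) x
  rw [gw_Iic2, gw_Iic1] at this
  linarith

lemma gw_add (f : ℝ → ℝ) (hf : Integrable f) (x : ℝ) :
    (∫ t in Set.Iic x, f t) + ∫ t in Set.Ioi x, f t = ∫ t, f t := by
  rw [← Set.compl_Iic]
  exact integral_add_compl measurableSet_Iic hf

lemma boundB (F : ℝ → ℝ) (hF : LipschitzWith 1 F) (x : ℝ) :
    |∫ t in Set.Ioi x, (F t - F x) * gw t| ≤ gw x - x * ∫ t in Set.Ioi x, gw t := by
  have e : gw x - x * ∫ t in Set.Ioi x, gw t = ∫ t in Set.Ioi x, (t * gw t - x * gw t) := by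
    rw [integral_sub gw_int1.integrableOn (gw_int0.const_mul _).integrableOn, gw_Ioi1,
      integral_const_mul]
  rw [e, ← Real.norm_eq_abs]
  refine norm_integral_le_of_norm_le (gw_int1.sub (gw_int0.const_mul _)).integrableOn ?_
  refine (ae_restrict_iff' measurableSet_Ioi).2 (Filter.Eventually.of_forall fun t ht => ?_)
  have h1 := hF.dist_le_mul t x
  simp only [Real.dist_eq, NNReal.coe_one, one_mul] at h1
  rw [abs_of_pos (a := t - x) (sub_pos.2 ht)] at h1
  rw [Real.norm_eq_abs, abs_mul, abs_of_pos (gw_pos t), ← sub_mul]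
  exact mul_le_mul_of_nonneg_right h1 (gw_pos t).le

lemma boundA (F : ℝ → ℝ) (hF : LipschitzWith 1 F) (x : ℝ) :
    |∫ t in Set.Iic x, (F t - F x) * gw t| ≤ gw x + x * ∫ t in Set.Iic x, gw t := by
  have e : gw x + x * ∫ t in Set.Iic x, gw t = ∫ t in Set.Iic x, (x * gw t - t * gw t) := by
    rw [integral_sub (gw_int0.const_mul _).integrableOn gw_int1.integrableOn, gw_Iic1,
      integral_const_mul]
    ring
  rw [e, ← Real.norm_eq_abs]
  refine norm_integral_le_of_norm_le ((gw_int0.const_mul _).sub gw_int1).integrableOn ?_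
  refine (ae_restrict_iff' measurableSet_Iic).2 (Filter.Eventually.of_forall fun t ht => ?_)
  have h1 := hF.dist_le_mul t x
  simp only [Real.dist_eq, NNReal.coe_one, one_mul] at h1
  rw [abs_of_nonpos (a := t - x) (sub_nonpos.2 ht)] at h1
  rw [Real.norm_eq_abs, abs_mul, abs_of_pos (gw_pos t), ← sub_mul]
  exact mul_le_mul_of_nonneg_right (by linarith) (gw_pos t).le

lemma alg_bound (x g P Q A B : ℝ) (hg : 0 < g) (hc : 0 < P + Q)
    (h1 : x * g ≤ (1 + x ^ 2) * Q) (h2 : -(x * g) ≤ (1 + x ^ 2) * P)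
    (hA : |A| ≤ g + x * P) (hB : |B| ≤ g - x * Q) :
    |(1 + x ^ 2) * (g⁻¹ * ((Q * A - P * B) / (P + Q))) + x * (-(A + B) / (P + Q))| ≤ 1 := by
  have e : (1 + x ^ 2) * (g⁻¹ * ((Q * A - P * B) / (P + Q))) + x * (-(A + B) / (P + Q))
      = (A * ((1 + x ^ 2) * Q - x * g) - B * ((1 + x ^ 2) * P + x * g)) / (g * (P + Q)) := by
    field_simp
    ring
  rw [e, abs_div, abs_of_pos (mul_pos hg hc), div_le_one (mul_pos hg hc)]
  calc _ ≤ |A * ((1 + x ^ 2) * Q - x * g)| + |B * ((1 + x ^ 2) * P + x * g)| := abs_sub _ _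
    _ = |A| * ((1 + x ^ 2) * Q - x * g) + |B| * ((1 + x ^ 2) * P + x * g) := by
      rw [abs_mul, abs_mul, abs_of_nonneg (sub_nonneg.2 h1),
        abs_of_nonneg (a := (1 + x ^ 2) * P + x * g) (by linarith)]
    _ ≤ (g + x * P) * ((1 + x ^ 2) * Q - x * g) + (g - x * Q) * ((1 + x ^ 2) * P + x * g) := by
      gcongr; linarith
    _ = g * (P + Q) := by ring

noncomputable def steinSol (F : ℝ → ℝ) (m : ℝ) (x : ℝ) : ℝ :=
  (gw x)⁻¹ * ∫ t in Set.Iic x, (F t - m) * gw t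

lemma int_sub (F : ℝ → ℝ) (hF : LipschitzWith 1 F) (m : ℝ) :
    Integrable (fun t => (F t - m) * gw t) := by
  simp only [sub_mul]
  exact (gw_lip_int F hF).sub (gw_int0.const_mul _)

lemma steinSol_hasDerivAt (F : ℝ → ℝ) (hF : LipschitzWith 1 F) (m x : ℝ) :
    HasDerivAt (steinSol F m) (F x - m + x * steinSol F m x) x := by
  have hint := int_sub F hF m
  have hcont : Continuous (fun t => (F t - m) * gw t) :=
    (hF.continuous.sub continuous_const).mul gw_continuous
  have h1 : HasDerivAt (fun x => ∫ t in Set.Iic x, (F t - m) * gw t) ((F x - m) * gw x) x := by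
    have h2 := intervalIntegral.integral_hasDerivAt_right (a := 0) (b := x)
      (hcont.intervalIntegrable _ _) (hcont.stronglyMeasurableAtFilter _ _) hcont.continuousAt
    have h3 := h2.const_add (∫ t in Set.Iic 0, (F t - m) * gw t)
    refine h3.congr_of_eventuallyEq (Filter.Eventually.of_forall fun y => ?_)
    have := intervalIntegral.integral_Iic_sub_Iic (a := 0) (b := y) hint.integrableOn
      hint.integrableOn
    simp only
    rw [← this]; ring
  have h4 := ((gw_hasDerivAt x).inv (gw_pos x).ne').mul h1
  unfold steinSol
  convert! h4 using 1
  have := (gw_pos x).ne'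
  simp only [Pi.inv_apply]
  field_simp
  ring

lemma stein_k_bound (F : ℝ → ℝ) (hF : LipschitzWith 1 F) (m x : ℝ)
    (hm : m * √(2 * π) = ∫ t, F t * gw t) :
    |steinSol F m x + x * (F x - m + x * steinSol F m x)| ≤ 1 := by
  have hPQ := gw_add gw gw_int0 x
  have hAB := gw_add _ (int_sub F hF (F x)) x
  have hc : 0 < √(2 * π) := by positivity
  rw [gw_total] at hPQ
  have e1 : ∫ t, (F t - F x) * gw t = (m - F x) * √(2 * π) := by
    simp only [sub_mul]
    rw [integral_sub (gw_lip_int F hF) (gw_int0.const_mul _), integral_const_mul, gw_total, hm]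
  have e2 : ∫ t in Set.Iic x, (F t - m) * gw t = (∫ t in Set.Iic x, (F t - F x) * gw t)
      + (F x - m) * ∫ t in Set.Iic x, gw t := by
    rw [← integral_const_mul, ← integral_add (int_sub F hF _).integrableOn
      (gw_int0.const_mul _).integrableOn]
    congr 1; ext t; ring
  have key := alg_bound x (gw x) _ _ _ _ (gw_pos x) (hPQ ▸ hc) (mills_Ioi x) (mills_Iic x)
    (boundA F hF x) (boundB F hF x)
  rw [e1] at hAB
  unfold steinSol
  rw [e2]
  generalize (∫ t in Set.Iic x, (F t - F x) * gw t) = A at *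
  generalize (∫ t in Set.Ioi x, (F t - F x) * gw t) = B at *
  generalize (∫ t in Set.Iic x, gw t) = p at *
  generalize (∫ t in Set.Ioi x, gw t) = q at *
  have hm' : F x - m = -(A + B) / (p + q) := by
    rw [hAB, hPQ]; field_simp; ring
  have h5 : A + (F x - m) * p = (q * A - p * B) / (p + q) := by
    rw [hm']; have : p + q ≠ 0 := by rw [hPQ]; exact hc.ne'
    field_simp; ring
  rw [h5, hm']
  convert key using 2
  ring

lemma stein_k_lip (F : ℝ → ℝ) (hF : LipschitzWith 1 F) (m : ℝ)
    (hm : m * √(2 * π) = ∫ t, F t * gw t) :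
    LipschitzWith 1 (fun x => x * steinSol F m x) := by
  have hd : ∀ x, HasDerivAt (fun x => x * steinSol F m x)
      (steinSol F m x + x * (F x - m + x * steinSol F m x)) x := fun x => by
    convert! (hasDerivAt_id x).mul (steinSol_hasDerivAt F hF m x) using 1
    simp
  refine lipschitzWith_of_nnnorm_deriv_le (fun x => (hd x).differentiableAt) fun x => ?_
  rw [(hd x).deriv, ← NNReal.coe_le_coe, coe_nnnorm, Real.norm_eq_abs]
  exact stein_k_bound F hF m x hm

lemma stein_deriv_lip (F : ℝ → ℝ) (hF : LipschitzWith 1 F) (m : ℝ)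
    (hm : m * √(2 * π) = ∫ t, F t * gw t) (x y : ℝ) :
    |(F y - m + y * steinSol F m y) - (F x - m + x * steinSol F m x)| ≤ 2 * |y - x| := by
  have h1 := hF.dist_le_mul y x
  have h2 := (stein_k_lip F hF m hm).dist_le_mul y x
  simp only [Real.dist_eq, NNReal.coe_one, one_mul] at h1 h2
  calc _ = |(F y - F x) + (y * steinSol F m y - x * steinSol F m x)| := by congr 1; ring
    _ ≤ _ := abs_add_le _ _
    _ ≤ _ := by linarith

lemma stein_bdd (F : ℝ → ℝ) (hF : LipschitzWith 1 F) (m : ℝ)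
    (hm : m * √(2 * π) = ∫ t, F t * gw t) (x : ℝ) : |steinSol F m x| ≤ max 1 |steinSol F m 0| := by
  by_cases hx : x = 0
  · subst hx; exact le_max_right _ _
  refine le_max_of_le_left ?_
  have h2 := (stein_k_lip F hF m hm).dist_le_mul x 0
  simp only [Real.dist_eq, NNReal.coe_one, one_mul, zero_mul, sub_zero, abs_mul] at h2
  have := abs_pos.2 hx
  nlinarith

lemma taylor_bound (f f' : ℝ → ℝ) (hf : ∀ x, HasDerivAt f (f' x) x)
    (hl : ∀ x y, |f' y - f' x| ≤ 2 * |y - x|) (w d : ℝ) (hd : 0 ≤ d) :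
    |f (w + d) - f w - d * f' w| ≤ d ^ 2 := by
  have hu : ∀ u, HasDerivAt (fun u => f (w + u) - f w - u * f' w) (f' (w + u) - f' w) u := by
    intro u
    have h1 : HasDerivAt (fun u => f (w + u)) (f' (w + u)) u := (hf (w + u)).comp_const_add w u
    have h2 := (h1.sub_const (f w)).sub ((hasDerivAt_id u).mul_const (f' w))
    rw [one_mul] at h2
    exact h2
  have := image_norm_le_of_norm_deriv_right_le_deriv_boundary (a := 0) (b := d)
    (f := fun u => f (w + u) - f w - u * f' w) (f' := fun u => f' (w + u) - f' w)
    (B := fun u => u ^ 2) (B' := fun u => 2 * u)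
    (fun u _ => (hu u).continuousAt.continuousWithinAt)
    (fun u _ => (hu u).hasDerivWithinAt) (by simp)
    (fun u => by simpa using hasDerivAt_pow 2 u)
    (fun u hu => by
      have := hl w (w + u)
      rw [Real.norm_eq_abs]
      rwa [add_sub_cancel_left, abs_of_nonneg hu.1] at this)
    (Set.right_mem_Icc.2 hd)
  simpa using this

lemma gauss_m (F : ℝ → ℝ) :
    (∫ x, F x ∂(gaussianReal 0 1)) * √(2 * π) = ∫ t, F t * gw t := by
  rw [integral_gaussianReal_eq_integral_smul one_ne_zero, ← integral_mul_const]
  congr 1; ext t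
  have : √(2 * π) ≠ 0 := by positivity
  simp only [gaussianPDFReal, gw, smul_eq_mul, NNReal.coe_one, mul_one, sub_zero]
  rw [show -t ^ 2 / 2 = -(1/2) * t ^ 2 by ring]
  field_simp

lemma poisson_integrable_shift (r : NNReal) (g : ℕ → ℝ) (C : ℝ) (hg : ∀ n, |g n| ≤ C) :
    Integrable g (poissonMeasure r) :=
  Integrable.of_bound Measurable.of_discrete.aestronglyMeasurable C
    (Filter.Eventually.of_forall hg)

lemma poisson_weight (r : NNReal) (n : ℕ) :
    Real.exp (-r) * (r:ℝ) ^ (n+1) / (n+1).factorial * ((n + 1 : ℕ) : ℝ)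
      = r * (Real.exp (-r) * (r:ℝ) ^ n / n.factorial) := by
  rw [Nat.factorial_succ]
  push_cast
  have : (n.factorial : ℝ) ≠ 0 := by positivity
  field_simp
  ring

lemma poisson_int_mul (r : NNReal) (g : ℕ → ℝ) (C : ℝ) (hg : ∀ n, |g n| ≤ C) :
    Integrable (fun n : ℕ => (n:ℝ) * g n) (poissonMeasure r) := by
  rw [integrable_poissonMeasure_iff, ← summable_nat_add_iff 1]
  have h := integrable_poissonMeasure_iff.1
    (poisson_integrable_shift r (fun n => g (n + 1)) C fun n => hg _)
  refine (h.mul_left (r : ℝ)).congr fun n => ?_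
  rw [norm_mul, ← mul_assoc, ← mul_assoc, Real.norm_of_nonneg (Nat.cast_nonneg _), poisson_weight]

lemma poisson_stein (r : NNReal) (g : ℕ → ℝ) (C : ℝ) (hg : ∀ n, |g n| ≤ C) :
    ∫ n : ℕ, (n:ℝ) * g n ∂(poissonMeasure r) = r * ∫ n, g (n + 1) ∂(poissonMeasure r) := by
  have h := hasSum_integral_poissonMeasure (poisson_int_mul r g C hg)
  have h' := hasSum_integral_poissonMeasure
    (poisson_integrable_shift r (fun n => g (n + 1)) C fun n => hg _)
  rw [← hasSum_nat_add_iff' 1] at h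
  have h2 := h'.mul_left (r : ℝ)
  have := h.unique (h2.congr_fun fun n => ?_)
  · simpa using this
  · simp only [smul_eq_mul]
    rw [← mul_assoc, ← mul_assoc, poisson_weight]

theorem poisson_gaussian_rubinstein_bound
    {Ω : Type*} [MeasurableSpace Ω] (P : Measure Ω) [IsProbabilityMeasure P]
    (lam : NNReal) (hlam : 0 < lam)
    (X : Ω → ℕ) (hX : Measurable X)
    (hlaw : Measure.map X P = poissonMeasure lam)
    (F : ℝ → ℝ) (hF : LipschitzWith 1 F) :
    |(∫ ω, F (((X ω : ℝ) - lam) / Real.sqrt lam) ∂P) - ∫ x, F x ∂(gaussianReal 0 1)|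
      ≤ 1 / Real.sqrt lam := by
  set s := Real.sqrt lam with hs
  have hs0 : 0 < s := Real.sqrt_pos.2 (by exact_mod_cast hlam)
  have hss : s * s = lam := Real.mul_self_sqrt lam.2
  have hm := gauss_m F
  set m := ∫ x, F x ∂(gaussianReal 0 1)
  set f := steinSol F m
  set w : ℕ → ℝ := fun n => ((n : ℝ) - lam) / s with hw
  have hmap : ∫ ω, F (((X ω : ℝ) - lam) / s) ∂P = ∫ n, F (w n) ∂(poissonMeasure lam) := by
    rw [← hlaw, integral_map hX.aemeasurable Measurable.of_discrete.aestronglyMeasurable]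
  rw [hmap]
  set C := max 1 |f 0|
  have hb : ∀ n, |f (w n)| ≤ C := fun n => stein_bdd F hF m hm _
  have hf : ∀ x, HasDerivAt f (F x - m + x * f x) x := steinSol_hasDerivAt F hF m
  have i0 := poisson_integrable_shift lam (fun n => f (w n)) C hb
  have i0' := poisson_integrable_shift lam (fun n => f (w (n + 1))) C fun n => hb _
  have i1 := poisson_int_mul lam (fun n => f (w n)) C hb
  have st := poisson_stein lam (fun n => f (w n)) C hb
  have hws : ∀ n, w (n + 1) = w n + 1 / s := fun n => by
    simp only [hw]; push_cast; ring
  have iw : Integrable w (poissonMeasure lam) := by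
    have := poisson_int_mul lam (fun _ => 1) 1 (by simp)
    simp only [mul_one] at this
    exact (this.sub (integrable_const _)).div_const _
  have iF : Integrable (fun n => F (w n)) (poissonMeasure lam) := by
    refine ((integrable_const |F 0|).add iw.abs).mono'
      Measurable.of_discrete.aestronglyMeasurable (Filter.Eventually.of_forall fun n => ?_)
    have h1 := hF.dist_le_mul (w n) 0
    simp only [Real.dist_eq, NNReal.coe_one, one_mul, sub_zero] at h1
    have := abs_sub_abs_le_abs_sub (F (w n)) (F 0)
    simp only [Real.norm_eq_abs, Pi.add_apply]
    linarith
  have e : (∫ n, F (w n) ∂(poissonMeasure lam)) - m = ∫ n : ℕ, ((F (w n) - m)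
      + (1 / s) * ((n : ℝ) * f (w n) - lam * f (w (n + 1)))) ∂(poissonMeasure lam) := by
    have j1 : Integrable (fun n => F (w n) - m) (poissonMeasure lam) :=
      iF.sub (integrable_const _)
    have j2 : Integrable (fun n : ℕ => (1 / s) * ((n : ℝ) * f (w n) - lam * f (w (n + 1))))
        (poissonMeasure lam) := (i1.sub (i0'.const_mul _)).const_mul _
    rw [integral_add j1 j2,
      integral_sub iF (integrable_const _), integral_const_mul, integral_sub i1 (i0'.const_mul _),
      integral_const_mul, st]
    simp
  rw [e, ← Real.norm_eq_abs]
  refine (norm_integral_le_of_norm_le_const (C := 1 / s)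
    (Filter.Eventually.of_forall fun n => ?_)).trans (by simp)
  have tb := taylor_bound f (fun x => F x - m + x * f x) hf (stein_deriv_lip F hF m hm)
    (w n) (1 / s) (by positivity)
  rw [← hws] at tb
  have e3 : (F (w n) - m) + (1 / s) * ((n : ℝ) * f (w n) - lam * f (w (n + 1)))
      = -s * (f (w (n + 1)) - f (w n) - 1 / s * (F (w n) - m + w n * f (w n))) := by
    have hn : (n : ℝ) = s * w n + s * s := by
      rw [hss]; simp only [hw]; field_simp; ring
    rw [← hss, hn]
    field_simp
    ring
  rw [e3, Real.norm_eq_abs, abs_mul, abs_neg, abs_of_pos hs0]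
  calc _ ≤ s * (1 / s) ^ 2 := by gcongr
    _ = 1 / s := by field_simp
end

section
/- Let λ > 0, let X_λ be a random variable with the Poisson distribution of parameter λ on ℕ, and set X̃_λ = (X_λ − λ)/√λ. Let F : ℝ → ℝ be Lipschitz and let ψ : ℝ → ℝ be three times continuously differentiable with ψ′, ψ″, ψ‴ bounded, satisfying the Stein equation x ψ(x) − ψ′(x) = F(x) − ∫_ℝ F dγ for all x ∈ ℝ. Then | E[F(X̃_λ)] − ∫_ℝ F dγ − (1/(2√λ)) ∫_ℝ ψ″ dγ | ≤ ‖ψ‴‖_∞ / λ. -/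
open MeasureTheory Real ProbabilityTheory

namespace PoissonStein

/-- unnormalised Gaussian density -/
noncomputable def ga (x : ℝ) : ℝ := Real.exp (-(1/2) * x ^ 2)

lemma ga_pos (x : ℝ) : 0 < ga x := Real.exp_pos _

lemma ga_cont : Continuous ga := by unfold ga; fun_prop

lemma ga_int : Integrable ga := integrable_exp_neg_mul_sq (by norm_num)

lemma ga_mul_int : Integrable (fun x => x * ga x) := integrable_mul_exp_neg_mul_sq (by norm_num)

lemma ga_deriv (x : ℝ) : HasDerivAt ga (-x * ga x) x := by
  have h : HasDerivAt (fun x : ℝ => -(1/2) * x ^ 2) (-x) x := by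
    have := (hasDerivAt_pow 2 x).const_mul (-(1/2) : ℝ)
    exact this.congr_deriv (by simp)
  exact h.exp.congr_deriv (by simp only [ga]; ring)

lemma ga_tendsto : Filter.Tendsto ga Filter.atTop (nhds 0) := by
  have : Filter.Tendsto (fun x : ℝ => -((1/2) * x ^ 2)) Filter.atTop Filter.atBot := by
    apply Filter.tendsto_neg_atTop_atBot.comp
    exact (Filter.tendsto_pow_atTop (by norm_num)).const_mul_atTop (by norm_num)
  have h := Real.tendsto_exp_atBot.comp this
  refine h.congr fun x => ?_
  simp [ga]

lemma ga_neg (x : ℝ) : ga (-x) = ga x := by simp [ga]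

lemma int_mul_ga (x : ℝ) : ∫ t in Set.Ioi x, t * ga t = ga x := by
  have := integral_Ioi_of_hasDerivAt_of_tendsto' (a := x) (f := fun t => - ga t)
    (f' := fun t => t * ga t) (m := 0) (fun t _ => by
      exact (ga_deriv t).neg.congr_deriv (by ring)) ga_mul_int.integrableOn (by
      simpa using ga_tendsto.neg)
  simpa using this

lemma mills (x : ℝ) : x * ga x ≤ (1 + x ^ 2) * ∫ t in Set.Ioi x, ga t := by
  have hpos : ∀ t : ℝ, 0 < 1 + t ^ 2 := fun t => by positivity
  have hd : ∀ t : ℝ, HasDerivAt (fun t => - (t / (1 + t ^ 2) * ga t))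
      ((1 - 2 / (1 + t ^ 2) ^ 2) * ga t) t := by
    intro t
    have h1 : HasDerivAt (fun t : ℝ => 1 + t ^ 2) (2 * t) t := by
      simpa using (hasDerivAt_pow 2 t).const_add (1 : ℝ)
    have h2 := (((hasDerivAt_id t).div h1 (hpos t).ne').mul (ga_deriv t)).neg
    refine h2.congr_deriv ?_
    have := (hpos t).ne'
    simp only [id, Pi.div_apply]
    field_simp
    ring
  have hb : ∀ t : ℝ, |1 - 2 / (1 + t ^ 2) ^ 2| ≤ 1 := by
    intro t
    have h1 : 1 ≤ (1 + t ^ 2) ^ 2 := one_le_pow₀ (by nlinarith [sq_nonneg t])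
    have h2 : 0 ≤ 2 / (1 + t ^ 2) ^ 2 := by positivity
    have h3 : 2 / (1 + t ^ 2) ^ 2 ≤ 2 := by
      rw [div_le_iff₀ (by positivity)]; linarith
    rw [abs_le]; constructor <;> linarith
  have hi : Integrable (fun t : ℝ => (1 - 2 / (1 + t ^ 2) ^ 2) * ga t) := by
    apply ga_int.bdd_mul (c := 1)
    · apply Continuous.aestronglyMeasurable
      refine continuous_const.sub (continuous_const.div (by fun_prop) fun t => ?_)
      have := hpos t
      positivity
    · exact Filter.Eventually.of_forall hb
  have ht : Filter.Tendsto (fun t : ℝ => - (t / (1 + t ^ 2) * ga t)) Filter.atTop (nhds 0) := by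
    refine squeeze_zero_norm (fun t => ?_) ga_tendsto
    rw [norm_neg, norm_mul, Real.norm_of_nonneg (ga_pos t).le, Real.norm_eq_abs, abs_div,
      abs_of_pos (hpos t)]
    refine mul_le_of_le_one_left (ga_pos t).le ?_
    rw [div_le_one (hpos t)]
    nlinarith [sq_nonneg (|t| - 1), sq_abs t, abs_nonneg t]
  have h := integral_Ioi_of_hasDerivAt_of_tendsto' (a := x) (fun t _ => hd t) hi.integrableOn ht
  have h2 : ∫ t in Set.Ioi x, (1 - 2 / (1 + t ^ 2) ^ 2) * ga t ≤ ∫ t in Set.Ioi x, ga t := by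
    apply integral_mono hi.integrableOn ga_int.integrableOn
    intro t
    exact mul_le_of_le_one_left (ga_pos t).le ((le_abs_self _).trans (hb t))
  rw [h] at h2
  have h3 := mul_le_mul_of_nonneg_left h2 (hpos x).le
  refine le_trans (le_of_eq ?_) h3
  have := (hpos x).ne'
  field_simp
  ring

lemma mills' (x : ℝ) : -x * ga x ≤ (1 + x ^ 2) * ∫ t in Set.Iic x, ga t := by
  have h := mills (-x)
  rw [← integral_comp_neg_Iic] at h
  simpa [ga_neg] using h

lemma core (g : ℝ → ℝ) (hg : Monotone g) (hi : Integrable (fun t => g t * ga t))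
    (h0 : ∫ t, g t * ga t = 0) (x : ℝ) :
    0 ≤ (∫ t in Set.Ioi x, g t * ga t) ∧
    x * g x * ga x ≤ (1 + x ^ 2) * ∫ t in Set.Ioi x, g t * ga t := by
  have hsum := intervalIntegral.integral_Iic_add_Ioi (b := x) hi.integrableOn hi.integrableOn
  rw [h0] at hsum
  have hR : g x * ∫ t in Set.Ioi x, ga t ≤ ∫ t in Set.Ioi x, g t * ga t := by
    rw [← integral_const_mul]
    apply setIntegral_mono_on (ga_int.const_mul _).integrableOn hi.integrableOn measurableSet_Ioi
    intro t ht
    exact mul_le_mul_of_nonneg_right (hg (le_of_lt ht)) (ga_pos t).le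
  have hL : ∫ t in Set.Iic x, g t * ga t ≤ g x * ∫ t in Set.Iic x, ga t := by
    rw [← integral_const_mul]
    apply setIntegral_mono_on hi.integrableOn (ga_int.const_mul _).integrableOn measurableSet_Iic
    intro t ht
    exact mul_le_mul_of_nonneg_right (hg ht) (ga_pos t).le
  have pR : 0 ≤ ∫ t in Set.Ioi x, ga t := integral_nonneg fun t => (ga_pos t).le
  have pL : 0 ≤ ∫ t in Set.Iic x, ga t := integral_nonneg fun t => (ga_pos t).le
  have mR := mills x
  have mL := mills' x
  have hx := ga_pos x
  have hpos : 0 < 1 + x ^ 2 := by positivity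
  set I := ∫ t in Set.Ioi x, g t * ga t
  set J := ∫ t in Set.Iic x, g t * ga t
  set R := ∫ t in Set.Ioi x, ga t
  set L := ∫ t in Set.Iic x, ga t
  have hI : 0 ≤ I := by
    rcases le_total 0 (g x) with h | h
    · exact (mul_nonneg h pR).trans hR
    · have : g x * L ≤ 0 := mul_nonpos_of_nonpos_of_nonneg h pL
      linarith
  refine ⟨hI, ?_⟩
  rcases le_total 0 (g x) with h | h
  · have h1 := mul_le_mul_of_nonneg_left mR h
    have h2 := mul_le_mul_of_nonneg_left hR hpos.le
    nlinarith
  · have h1 := mul_le_mul_of_nonneg_left mL (neg_nonneg.2 h)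
    have h2 := mul_le_mul_of_nonneg_left hL hpos.le
    have h3 : J = -I := by linarith
    rw [h3] at h2
    nlinarith

lemma gauss_int (f : ℝ → ℝ) :
    ∫ x, f x ∂(gaussianReal 0 1) = (√(2 * π))⁻¹ * ∫ x, f x * ga x := by
  rw [integral_gaussianReal_eq_integral_smul one_ne_zero, ← integral_const_mul]
  congr 1; ext x
  simp only [gaussianPDFReal, ga, smul_eq_mul]
  have : -(x - 0) ^ 2 / (2 * ((1 : NNReal) : ℝ)) = -(1/2) * x ^ 2 := by
    push_cast; ring
  rw [this]; simp; ring

lemma stein_exists (G G' : ℝ → ℝ) (M : ℝ) (hG : ∀ x, HasDerivAt G (G' x) x)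
    (hM : ∀ x, |G' x| ≤ M) (hb : ∃ C, ∀ x, |G x| ≤ C) :
    ∃ p p' p'' : ℝ → ℝ, (∀ x, HasDerivAt p (p' x) x) ∧ (∀ x, HasDerivAt p' (p'' x) x) ∧
      (∀ x, |p x| ≤ M) ∧ (∀ x, |p'' x| ≤ 2 * M) ∧
      ∀ x, x * p x - p' x = G x - ∫ y, G y ∂(gaussianReal 0 1) := by
  obtain ⟨C, hC⟩ := hb
  set c := ∫ y, G y ∂(gaussianReal 0 1) with hc
  have Gc : Continuous G := continuous_iff_continuousAt.2 fun x => (hG x).continuousAt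
  have hGi : Integrable (fun t => G t * ga t) :=
    ga_int.bdd_mul (c := C) Gc.aestronglyMeasurable (Filter.Eventually.of_forall hC)
  let g : ℝ → ℝ := fun x => G x - c
  have hgd : ∀ x, HasDerivAt g (G' x) x := fun x => (hG x).sub_const c
  have hgc : Continuous g := Gc.sub continuous_const
  have hgi : Integrable (fun t => g t * ga t) := by
    simp only [g, sub_mul]
    exact hGi.sub (ga_int.const_mul c)
  have hga1 : (√(2 * π))⁻¹ * ∫ x, ga x = 1 := by
    have := gauss_int (fun _ => 1)
    simpa using this.symm
  have hs : (√(2 * π))⁻¹ ≠ 0 := by positivity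
  have hg0 : ∫ t, g t * ga t = 0 := by
    have : (√(2 * π))⁻¹ * ∫ t, g t * ga t = 0 := by
      simp only [g, sub_mul]
      rw [integral_sub hGi (ga_int.const_mul c), mul_sub, integral_const_mul, ← gauss_int, ← hc]
      linear_combination -c * hga1
    exact (mul_eq_zero.1 this).resolve_left hs
  have hx0 : ∫ t, t * ga t = 0 := by
    have := gauss_int (fun x => x)
    simp at this
    rcases this with h | h
    · have : 0 < √π := by positivity
      exact absurd h this.ne'
    · exact h
  let I : ℝ → ℝ := fun x => ∫ t in Set.Ioi x, g t * ga t
  -- bounds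
  have key1 := fun x => core (fun t => M * t - g t) (by
      apply monotone_of_hasDerivAt_nonneg (f' := fun t => M - G' t)
      · intro t
        exact (((hasDerivAt_id t).const_mul M).sub (hgd t)).congr_deriv (by simp)
      · intro t
        have := (abs_le.1 (hM t)).2
        simp only [Pi.zero_apply]; linarith) (by
      simp only [sub_mul, mul_assoc]; exact (ga_mul_int.const_mul M).sub hgi) (by
      simp only [sub_mul, mul_assoc]
      rw [integral_sub (ga_mul_int.const_mul M) hgi, integral_const_mul, hx0, hg0]; simp) x
  have key2 := fun x => core (fun t => M * t + g t) (by
      apply monotone_of_hasDerivAt_nonneg (f' := fun t => M + G' t)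
      · intro t
        exact (((hasDerivAt_id t).const_mul M).add (hgd t)).congr_deriv (by simp)
      · intro t
        have := (abs_le.1 (hM t)).1
        simp only [Pi.zero_apply]; linarith) (by
      simp only [add_mul, mul_assoc]; exact (ga_mul_int.const_mul M).add hgi) (by
      simp only [add_mul, mul_assoc]
      rw [integral_add (ga_mul_int.const_mul M) hgi, integral_const_mul, hx0, hg0]; simp) x
  have e1 : ∀ x, ∫ t in Set.Ioi x, (M * t - g t) * ga t = M * ga x - I x := by
    intro x
    simp only [sub_mul, mul_assoc]
    rw [integral_sub (ga_mul_int.const_mul M).integrableOn hgi.integrableOn, integral_const_mul,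
      int_mul_ga]
  have e2 : ∀ x, ∫ t in Set.Ioi x, (M * t + g t) * ga t = M * ga x + I x := by
    intro x
    simp only [add_mul, mul_assoc]
    rw [integral_add (ga_mul_int.const_mul M).integrableOn hgi.integrableOn, integral_const_mul,
      int_mul_ga]
  simp only [e1, e2] at key1 key2
  have hId : ∀ x, HasDerivAt I (-(g x * ga x)) x := by
    intro x
    have hcont : Continuous fun t => g t * ga t := hgc.mul ga_cont
    have h1 : HasDerivAt (fun x => ∫ t in (0:ℝ)..x, g t * ga t) (g x * ga x) x :=
      intervalIntegral.integral_hasDerivAt_right (hcont.intervalIntegrable _ _)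
        (hcont.stronglyMeasurableAtFilter _ _) hcont.continuousAt
    have h2 : I = fun x => I 0 - ∫ t in (0:ℝ)..x, g t * ga t := by
      ext y
      have := intervalIntegral.integral_Ioi_sub_Ioi' (a := 0) (b := y)
        hgi.integrableOn hgi.integrableOn
      simp only [I]; linarith
    rw [h2]
    exact h1.const_sub _
  let p : ℝ → ℝ := fun x => I x / ga x
  have hpI : ∀ x, p x * ga x = I x := fun x => div_mul_cancel₀ _ (ga_pos x).ne'
  have hp : ∀ x, HasDerivAt p (x * p x - g x) x := by
    intro x
    have h := (hId x).div (ga_deriv x) (ga_pos x).ne'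
    refine h.congr_deriv ?_
    have := (ga_pos x).ne'
    simp only [p]
    field_simp
    ring
  refine ⟨p, fun x => x * p x - g x, fun x => p x + x * (x * p x - g x) - G' x, hp, ?_, ?_, ?_, ?_⟩
  · intro x
    have := ((hasDerivAt_id x).mul (hp x)).sub (hgd x)
    refine this.congr_deriv ?_
    simp
  · intro x
    have h1 := (key1 x).1
    have h2 := (key2 x).1
    rw [← hpI] at h1 h2
    have := ga_pos x
    rw [abs_le]
    constructor <;> · refine le_of_mul_le_mul_right (a := ga x) ?_ this; linarith
  · intro x
    have h1 := (key1 x).2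
    have h2 := (key2 x).2
    rw [← hpI] at h1 h2
    have := ga_pos x
    have h3 := abs_le.1 (hM x)
    have h4 : p x + x * (x * p x - g x) ≤ M := by
      refine le_of_mul_le_mul_right (a := ga x) ?_ this; linarith
    have h5 : -M ≤ p x + x * (x * p x - g x) := by
      refine le_of_mul_le_mul_right (a := ga x) ?_ this; linarith
    rw [abs_le]
    constructor <;> linarith [h3.1, h3.2]
  · intro x
    simp only [g]; ring

lemma nonpos_of (r r' : ℝ → ℝ) (h0 : r 0 ≤ 0) (hd : ∀ t, HasDerivAt r (r' t) t)
    (hr : ∀ t, 0 ≤ t → r' t ≤ 0) (t : ℝ) (ht : 0 ≤ t) : r t ≤ 0 := by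
  have hdiff : Differentiable ℝ r := fun t => (hd t).differentiableAt
  have h := antitoneOn_of_deriv_nonpos (convex_Ici (0:ℝ)) hdiff.continuous.continuousOn
    hdiff.differentiableOn (by
      intro x hx
      rw [interior_Ici] at hx
      rw [(hd x).deriv]
      exact hr x (le_of_lt hx))
  exact (h (Set.self_mem_Ici) ht ht).trans h0

lemma hasDerivAt_shift {p p' : ℝ → ℝ} (h : ∀ x, HasDerivAt p (p' x) x) (x t : ℝ) :
    HasDerivAt (fun t => p (x + t)) (p' (x + t)) t :=
  (h (x + t)).comp_const_add x t

lemma taylor1 (p p' : ℝ → ℝ) (C : ℝ) (h1 : ∀ x, HasDerivAt p (p' x) x)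
    (hC : ∀ x, p' x ≤ C) (x t : ℝ) (ht : 0 ≤ t) :
    p (x + t) - p x - C * t ≤ 0 := by
  refine nonpos_of (fun t => p (x + t) - p x - C * t) (fun t => p' (x + t) - C) (by simp)
    (fun t => ?_) (fun t _ => by have := hC (x + t); linarith) t ht
  exact (((hasDerivAt_shift h1 x t).sub_const _).sub ((hasDerivAt_id t).const_mul C)).congr_deriv
    (by simp)

lemma taylor2 (p p' p'' : ℝ → ℝ) (C : ℝ) (h1 : ∀ x, HasDerivAt p (p' x) x)
    (h2 : ∀ x, HasDerivAt p' (p'' x) x) (hC : ∀ x, p'' x ≤ C) (x t : ℝ) (ht : 0 ≤ t) :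
    p (x + t) - p x - t * p' x - C * t ^ 2 / 2 ≤ 0 := by
  refine nonpos_of (fun t => p (x + t) - p x - t * p' x - C * t ^ 2 / 2)
    (fun t => p' (x + t) - p' x - C * t) (by simp)
    (fun t => ?_) (fun t ht => taylor1 p' p'' C h2 hC x t ht) t ht
  exact ((((hasDerivAt_shift h1 x t).sub_const _).sub ((hasDerivAt_id t).mul_const _)).sub
    (((hasDerivAt_pow 2 t).const_mul C).div_const 2)).congr_deriv
    (by simp; ring)

lemma taylor3 (p p' p'' p3 : ℝ → ℝ) (C : ℝ) (h1 : ∀ x, HasDerivAt p (p' x) x)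
    (h2 : ∀ x, HasDerivAt p' (p'' x) x) (h3 : ∀ x, HasDerivAt p'' (p3 x) x)
    (hC : ∀ x, p3 x ≤ C) (x t : ℝ) (ht : 0 ≤ t) :
    p (x + t) - p x - t * p' x - t ^ 2 / 2 * p'' x - C * t ^ 3 / 6 ≤ 0 := by
  refine nonpos_of (fun t => p (x + t) - p x - t * p' x - t ^ 2 / 2 * p'' x - C * t ^ 3 / 6)
    (fun t => p' (x + t) - p' x - t * p'' x - C * t ^ 2 / 2) (by simp)
    (fun t => ?_) (fun t ht => taylor2 p' p'' p3 C h2 h3 hC x t ht) t ht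
  exact (((((hasDerivAt_shift h1 x t).sub_const _).sub ((hasDerivAt_id t).mul_const _)).sub
    (((hasDerivAt_pow 2 t).div_const 2).mul_const _)).sub
    (((hasDerivAt_pow 3 t).const_mul C).div_const 6)).congr_deriv
    (by simp; ring)

lemma taylor2_abs (p p' p'' : ℝ → ℝ) (C : ℝ) (h1 : ∀ x, HasDerivAt p (p' x) x)
    (h2 : ∀ x, HasDerivAt p' (p'' x) x) (hC : ∀ x, |p'' x| ≤ C) (x t : ℝ) (ht : 0 ≤ t) :
    |p (x + t) - p x - t * p' x| ≤ C * t ^ 2 / 2 := by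
  have a := taylor2 p p' p'' C h1 h2 (fun x => (abs_le.1 (hC x)).2) x t ht
  have b := taylor2 (fun x => - p x) (fun x => - p' x) (fun x => - p'' x) C
    (fun x => (h1 x).neg) (fun x => (h2 x).neg)
    (fun x => by have := (abs_le.1 (hC x)).1; linarith) x t ht
  rw [abs_le]; constructor <;> linarith

lemma taylor3_abs (p p' p'' p3 : ℝ → ℝ) (C : ℝ) (h1 : ∀ x, HasDerivAt p (p' x) x)
    (h2 : ∀ x, HasDerivAt p' (p'' x) x) (h3 : ∀ x, HasDerivAt p'' (p3 x) x)
    (hC : ∀ x, |p3 x| ≤ C) (x t : ℝ) (ht : 0 ≤ t) :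
    |p (x + t) - p x - t * p' x - t ^ 2 / 2 * p'' x| ≤ C * t ^ 3 / 6 := by
  have a := taylor3 p p' p'' p3 C h1 h2 h3 (fun x => (abs_le.1 (hC x)).2) x t ht
  have b := taylor3 (fun x => - p x) (fun x => - p' x) (fun x => - p'' x) (fun x => - p3 x) C
    (fun x => (h1 x).neg) (fun x => (h2 x).neg) (fun x => (h3 x).neg)
    (fun x => by have := (abs_le.1 (hC x)).1; linarith) x t ht
  rw [abs_le]; constructor <;> linarith

/-- a function with bounded derivative has linear growth -/
lemma lin_growth (p p' : ℝ → ℝ) (C : ℝ) (h1 : ∀ x, HasDerivAt p (p' x) x)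
    (hC : ∀ x, |p' x| ≤ C) (x : ℝ) : |p x| ≤ (|p 0| + C) * (1 + |x|) := by
  have h := Convex.norm_image_sub_le_of_norm_hasDerivWithin_le (f := p) (f' := p') (C := C)
    (s := Set.univ) (fun x _ => (h1 x).hasDerivWithinAt) (fun x _ => hC x) convex_univ
    (Set.mem_univ 0) (Set.mem_univ x)
  simp only [Real.norm_eq_abs, sub_zero] at h
  have hC0 : 0 ≤ C := (abs_nonneg _).trans (hC 0)
  have h2 : |p x| ≤ |p x - p 0| + |p 0| := by
    simpa using abs_add_le (p x - p 0) (p 0)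
  nlinarith [abs_nonneg x, abs_nonneg (p 0), mul_nonneg (abs_nonneg (p 0)) (abs_nonneg x)]

lemma pois_integrable (lam : NNReal) (f : ℕ → ℝ) (A : ℝ)
    (h : ∀ n, |f n| ≤ A * (1 + (n : ℝ)) ^ 2) : Integrable f (poissonMeasure lam) := by
  rw [integrable_poissonMeasure_iff]
  have hs : Summable (fun n : ℕ => A * Real.exp (-lam) * (((4 : ℝ) * lam) ^ n / n.factorial)) :=
    (Real.summable_pow_div_factorial _).mul_left _
  have hA : 0 ≤ A := by
    have := (abs_nonneg _).trans (h 0)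
    simpa using this
  refine Summable.of_nonneg_of_le (fun n => by positivity) (fun n => ?_) hs
  have h1 : (1 + (n : ℝ)) ^ 2 ≤ 4 ^ n := by
    have : (n : ℝ) + 1 ≤ 2 ^ n := by exact_mod_cast Nat.lt_two_pow_self (n := n)
    calc (1 + (n : ℝ)) ^ 2 ≤ (2 ^ n) ^ 2 := by
          apply pow_le_pow_left₀ (by positivity); linarith
      _ = 4 ^ n := by rw [← pow_mul, mul_comm, pow_mul]; norm_num
  calc Real.exp (-lam) * lam ^ n / n.factorial * ‖f n‖
      ≤ Real.exp (-lam) * lam ^ n / n.factorial * (A * 4 ^ n) := by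
        apply mul_le_mul_of_nonneg_left _ (by positivity)
        exact (h n).trans (mul_le_mul_of_nonneg_left h1 hA)
    _ = A * Real.exp (-lam) * (((4 : ℝ) * lam) ^ n / n.factorial) := by
        rw [mul_pow]; ring

lemma chen (lam : NNReal) (f : ℕ → ℝ) (A : ℝ)
    (h : ∀ n, |f n| ≤ A * (1 + (n : ℝ))) :
    ∫ n : ℕ, (n : ℝ) * f n ∂(poissonMeasure lam) =
      lam * ∫ n : ℕ, f (n + 1) ∂(poissonMeasure lam) := by
  have hi : Integrable (fun n : ℕ => (n : ℝ) * f n) (poissonMeasure lam) := by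
    refine pois_integrable lam _ A fun n => ?_
    rw [abs_mul, Nat.abs_cast]
    have h1 := mul_le_mul_of_nonneg_left (h n) (Nat.cast_nonneg (α := ℝ) n)
    have h2 := (abs_nonneg _).trans (h n)
    nlinarith
  have hs := (hasSum_integral_poissonMeasure hi).summable
  rw [integral_poissonMeasure' hi, hs.tsum_eq_zero_add, integral_poissonMeasure, ← tsum_mul_left]
  simp only [Nat.cast_zero, zero_mul, smul_zero, zero_add]
  congr 1; ext n
  rw [Nat.factorial_succ]
  have h1 : (n.factorial : ℝ) ≠ 0 := by positivity
  have h2 : ((n : ℝ) + 1) ≠ 0 := by positivity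
  simp only [smul_eq_mul]
  push_cast
  field_simp
  ring

/-- normalised atom -/
noncomputable def ya (lam : NNReal) (n : ℕ) : ℝ := ((n : ℝ) - lam) / √(lam : ℝ)

lemma ya_succ (lam : NNReal) (n : ℕ) : ya lam (n + 1) = ya lam n + 1 / √(lam : ℝ) := by
  unfold ya; push_cast; ring

lemma ya_growth (lam : NNReal) :
    ∃ B : ℝ, 0 ≤ B ∧ ∀ n : ℕ, 1 + |ya lam n| ≤ B * (1 + (n : ℝ)) := by
  refine ⟨1 + (1 + lam) / √(lam : ℝ), by positivity, fun n => ?_⟩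
  have h1 : |ya lam n| ≤ (1 + lam) / √(lam : ℝ) * (1 + n) := by
    unfold ya
    rw [abs_div, abs_of_nonneg (Real.sqrt_nonneg _), div_mul_eq_mul_div]
    apply div_le_div_of_nonneg_right _ (Real.sqrt_nonneg _)
    have h0 : (0 : ℝ) ≤ lam := lam.2
    have hn : (0 : ℝ) ≤ n := Nat.cast_nonneg n
    rw [abs_le]; constructor <;> nlinarith
  have hn : (0 : ℝ) ≤ n := Nat.cast_nonneg n
  linarith

lemma pois_integrable_ya (lam : NNReal) (q : ℝ → ℝ) (A : ℝ)
    (h : ∀ x, |q x| ≤ A * (1 + |x|) ^ 2) :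
    Integrable (fun n => q (ya lam n)) (poissonMeasure lam) := by
  obtain ⟨B, hB, hy⟩ := ya_growth lam
  have hA : 0 ≤ A := by
    have := (abs_nonneg _).trans (h 0)
    simpa using this
  refine pois_integrable lam _ (A * B ^ 2) fun n => (h _).trans ?_
  rw [mul_assoc, ← mul_pow]
  exact mul_le_mul_of_nonneg_left (pow_le_pow_left₀ (by positivity) (hy n) 2) hA

lemma lin_sq {a A x : ℝ} (h : a ≤ A * (1 + |x|)) (ha : 0 ≤ a) : a ≤ A * (1 + |x|) ^ 2 := by
  have := ha.trans h
  nlinarith [abs_nonneg x]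

lemma pois_stein (lam : NNReal) (hlam : 0 < lam) (p p' : ℝ → ℝ) (A A' : ℝ)
    (h : ∀ x, |p x| ≤ A * (1 + |x|)) (h' : ∀ x, |p' x| ≤ A' * (1 + |x|)) :
    Integrable (fun n => ya lam n * p (ya lam n) - p' (ya lam n)) (poissonMeasure lam) ∧
    ∫ n, (ya lam n * p (ya lam n) - p' (ya lam n)) ∂(poissonMeasure lam) =
    √(lam : ℝ) * ∫ n, (p (ya lam n + 1 / √(lam : ℝ)) - p (ya lam n)
      - 1 / √(lam : ℝ) * p' (ya lam n)) ∂(poissonMeasure lam) := by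
  obtain ⟨B, hB, hy⟩ := ya_growth lam
  have hl : (0 : ℝ) < lam := hlam
  have hs : 0 < √(lam : ℝ) := Real.sqrt_pos.2 hl
  have hss : √(lam : ℝ) * √(lam : ℝ) = lam := Real.mul_self_sqrt hl.le
  have hA : 0 ≤ A := by
    have := (abs_nonneg _).trans (h 0)
    simpa using this
  have ip := pois_integrable_ya lam p A fun x => lin_sq (h x) (abs_nonneg _)
  have ip' := pois_integrable_ya lam p' A' fun x => lin_sq (h' x) (abs_nonneg _)
  have iyp : Integrable (fun n => ya lam n * p (ya lam n)) (poissonMeasure lam) := by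
    refine pois_integrable_ya lam (fun x => x * p x) A fun x => ?_
    rw [abs_mul]
    have := mul_le_mul_of_nonneg_left (h x) (abs_nonneg x)
    have := (abs_nonneg _).trans (h x)
    nlinarith [abs_nonneg x]
  have inp : Integrable (fun n : ℕ => (n : ℝ) * p (ya lam n)) (poissonMeasure lam) := by
    refine ((iyp.const_mul (√(lam : ℝ))).add (ip.const_mul (lam : ℝ))).congr ?_
    refine Filter.Eventually.of_forall fun n => ?_
    simp only [Pi.add_apply, ya]
    field_simp
    ring
  have gp : ∀ n : ℕ, |p (ya lam n)| ≤ A * B * (1 + (n : ℝ)) := fun n =>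
    (h _).trans (by rw [mul_assoc]; exact mul_le_mul_of_nonneg_left (hy n) hA)
  have isp : Integrable (fun n : ℕ => p (ya lam n + 1 / √(lam : ℝ))) (poissonMeasure lam) := by
    refine pois_integrable lam _ (4 * (A * B)) fun n => ?_
    rw [← ya_succ]
    refine (gp (n + 1)).trans ?_
    have hn : (0 : ℝ) ≤ n := Nat.cast_nonneg n
    have hAB : 0 ≤ A * B := mul_nonneg hA hB
    push_cast
    have : 1 + ((n : ℝ) + 1) ≤ 4 * (1 + (n : ℝ)) ^ 2 := by nlinarith
    have := mul_le_mul_of_nonneg_left this hAB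
    linarith
  have hch := chen lam (fun n => p (ya lam n)) (A * B) gp
  simp only [ya_succ] at hch
  refine ⟨iyp.sub ip', ?_⟩
  have e1 : ∫ n, ya lam n * p (ya lam n) ∂(poissonMeasure lam) =
      1 / √(lam : ℝ) * ∫ n : ℕ, (n : ℝ) * p (ya lam n) ∂(poissonMeasure lam)
      - √(lam : ℝ) * ∫ n, p (ya lam n) ∂(poissonMeasure lam) := by
    rw [← integral_const_mul, ← integral_const_mul,
      ← integral_sub (inp.const_mul _) (ip.const_mul _)]
    congr 1; ext n
    simp only [ya]
    field_simp
    rw [Real.sq_sqrt hl.le]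
    ring
  have e2 : ∫ n, (p (ya lam n + 1 / √(lam : ℝ)) - p (ya lam n)
      - 1 / √(lam : ℝ) * p' (ya lam n)) ∂(poissonMeasure lam) =
      (∫ n, p (ya lam n + 1 / √(lam : ℝ)) ∂(poissonMeasure lam))
      - (∫ n, p (ya lam n) ∂(poissonMeasure lam))
      - 1 / √(lam : ℝ) * ∫ n, p' (ya lam n) ∂(poissonMeasure lam) := by
    rw [← integral_const_mul, ← integral_sub isp ip]
    exact integral_sub (isp.sub ip) (ip'.const_mul _)
  have e3 : 1 / √(lam : ℝ) * lam = √(lam : ℝ) := by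
    rw [one_div_mul_eq_div, div_eq_iff hs.ne', hss]
  have e4 : √(lam : ℝ) * (1 / √(lam : ℝ)) = 1 := mul_one_div_cancel hs.ne'
  rw [integral_sub iyp ip', e1, hch, e2, ← mul_assoc, e3, mul_sub, mul_sub, ← mul_assoc _ (1 / _), e4]
  ring

end PoissonStein

/-- First refinement of the Stein bound for the normalized Poisson variable: if `ψ ∈ C³`
with bounded `ψ′, ψ″, ψ‴` solves the Stein equation
`x ψ(x) − ψ′(x) = F(x) − ∫ F dN(0,1)` for a Lipschitz `F`, then
`|E[F(X̃_λ)] − ∫ F dγ − (1/(2√λ)) ∫ ψ″ dγ| ≤ ‖ψ‴‖_∞ / λ`. -/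
theorem poisson_stein_first_order_expansion
    {Ω : Type*} [MeasurableSpace Ω] (P : Measure Ω) [IsProbabilityMeasure P]
    (lam : NNReal) (hlam : 0 < lam)
    (X : Ω → ℕ) (hX : Measurable X)
    (hlaw : Measure.map X P = poissonMeasure lam)
    (F : ℝ → ℝ) (K : NNReal) (hF : LipschitzWith K F)
    (ψ : ℝ → ℝ) (hψ : ContDiff ℝ 3 ψ)
    (hψb : ∀ i, 1 ≤ i → i ≤ 3 → ∃ C, ∀ x, |iteratedDeriv i ψ x| ≤ C)
    (hstein : ∀ x : ℝ, x * ψ x - deriv ψ x = F x - ∫ y, F y ∂(gaussianReal 0 1)) :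
    |(∫ ω, F (((X ω : ℝ) - lam) / Real.sqrt lam) ∂P)
        - (∫ x, F x ∂(gaussianReal 0 1))
        - (1 / (2 * Real.sqrt lam)) * ∫ x, iteratedDeriv 2 ψ x ∂(gaussianReal 0 1)|
      ≤ (⨆ x : ℝ, |iteratedDeriv 3 ψ x|) / lam := by
  have hl : (0 : ℝ) < lam := hlam
  set s := √(lam : ℝ) with hsdef
  have hs : 0 < s := Real.sqrt_pos.2 hl
  have hss : s * s = lam := Real.mul_self_sqrt hl.le
  -- transfer to the Poisson measure
  have hE : ∫ ω, F (((X ω : ℝ) - lam) / s) ∂P =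
      ∫ n, F (PoissonStein.ya lam n) ∂(poissonMeasure lam) := by
    rw [← hlaw, integral_map hX.aemeasurable (measurable_from_nat.aestronglyMeasurable)]
    rfl
  rw [hE]
  obtain ⟨C1, hC1⟩ := hψb 1 le_rfl (by norm_num)
  obtain ⟨C2, hC2⟩ := hψb 2 (by norm_num) (by norm_num)
  obtain ⟨C3, hC3⟩ := hψb 3 (by norm_num) le_rfl
  have hd : ∀ k : ℕ, k < 3 → ∀ x, HasDerivAt (iteratedDeriv k ψ) (iteratedDeriv (k + 1) ψ x) x := by
    intro k hk x
    rw [iteratedDeriv_succ]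
    exact ((hψ.differentiable_iteratedDeriv k (by exact_mod_cast hk)) x).hasDerivAt
  have d1 : ∀ x, HasDerivAt ψ (iteratedDeriv 1 ψ x) x := by
    simpa using hd 0 (by norm_num)
  have d2 := hd 1 (by norm_num)
  have d3 := hd 2 (by norm_num)
  set M := ⨆ x : ℝ, |iteratedDeriv 3 ψ x| with hMdef
  have hM : ∀ x, |iteratedDeriv 3 ψ x| ≤ M := fun x =>
    le_ciSup (f := fun x : ℝ => |iteratedDeriv 3 ψ x|) ⟨C3, by rintro _ ⟨x, rfl⟩; exact hC3 x⟩ x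
  have hM0 : 0 ≤ M := (abs_nonneg _).trans (hM 0)
  -- step 1: the second derivative
  obtain ⟨p, p', p'', hp, hp', hpb, hpb'', hpS⟩ :=
    PoissonStein.stein_exists (iteratedDeriv 2 ψ) (iteratedDeriv 3 ψ) M d3 hM ⟨C2, hC2⟩
  set cG := ∫ y, iteratedDeriv 2 ψ y ∂(gaussianReal 0 1) with hcG
  set cF := ∫ y, F y ∂(gaussianReal 0 1) with hcF
  have iG : Integrable (fun n => iteratedDeriv 2 ψ (PoissonStein.ya lam n)) (poissonMeasure lam) := by
    refine PoissonStein.pois_integrable_ya lam _ C2 fun x => ?_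
    refine PoissonStein.lin_sq ?_ (abs_nonneg _)
    have h0 := (abs_nonneg _).trans (hC2 x)
    have := hC2 x
    nlinarith [abs_nonneg x]
  have hst : (0 : ℝ) ≤ 1 / s := by positivity
  have hG : |∫ n, iteratedDeriv 2 ψ (PoissonStein.ya lam n) ∂(poissonMeasure lam) - cG|
      ≤ M / s := by
    have key := PoissonStein.pois_stein lam hlam p p' M _ (fun x => by
      have := hpb x
      nlinarith [abs_nonneg x]) (PoissonStein.lin_growth p' p'' _ hp' hpb'')
    simp only [hpS] at key
    have h2 := key.2
    rw [integral_sub iG (integrable_const _)] at h2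
    simp only [integral_const, probReal_univ, one_smul] at h2
    rw [h2, abs_mul, abs_of_pos hs]
    have h3 := norm_integral_le_of_norm_le_const (μ := poissonMeasure lam)
      (f := fun n => p (PoissonStein.ya lam n + 1 / s) - p (PoissonStein.ya lam n)
        - 1 / s * p' (PoissonStein.ya lam n)) (C := 2 * M * (1 / s) ^ 2 / 2)
      (Filter.Eventually.of_forall fun n =>
        PoissonStein.taylor2_abs p p' p'' _ hp hp' hpb'' _ _ hst)
    simp only [probReal_univ, mul_one, Real.norm_eq_abs] at h3
    refine (mul_le_mul_of_nonneg_left h3 hs.le).trans (le_of_eq ?_)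
    field_simp
  -- step 2: the expansion for F
  have key := PoissonStein.pois_stein lam hlam ψ (iteratedDeriv 1 ψ) _ C1
    (PoissonStein.lin_growth ψ _ C1 d1 hC1) (fun x => by
      have h0 := (abs_nonneg _).trans (hC1 x)
      have := hC1 x
      nlinarith [abs_nonneg x])
  simp only [iteratedDeriv_one, hstein] at key
  obtain ⟨iF', hF2⟩ := key
  have iF : Integrable (fun n => F (PoissonStein.ya lam n)) (poissonMeasure lam) := by
    refine (iF'.add (integrable_const cF)).congr (Filter.Eventually.of_forall fun n => ?_)
    simp
  rw [integral_sub iF (integrable_const _)] at hF2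
  simp only [integral_const, probReal_univ, one_smul] at hF2
  have tay : ∀ x, |ψ (x + 1 / s) - ψ x - 1 / s * deriv ψ x - (1 / s) ^ 2 / 2 * iteratedDeriv 2 ψ x|
      ≤ M * (1 / s) ^ 3 / 6 := by
    intro x
    simpa only [iteratedDeriv_one] using
      PoissonStein.taylor3_abs ψ _ _ _ M d1 d2 d3 hM x (1 / s) hst
  have iR : Integrable (fun n => ψ (PoissonStein.ya lam n + 1 / s) - ψ (PoissonStein.ya lam n)
      - 1 / s * deriv ψ (PoissonStein.ya lam n)
      - (1 / s) ^ 2 / 2 * iteratedDeriv 2 ψ (PoissonStein.ya lam n)) (poissonMeasure lam) :=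
    Integrable.of_bound measurable_from_nat.aestronglyMeasurable _
      (Filter.Eventually.of_forall fun n => tay _)
  have hR := norm_integral_le_of_norm_le_const (μ := poissonMeasure lam)
    (f := fun n => ψ (PoissonStein.ya lam n + 1 / s) - ψ (PoissonStein.ya lam n)
      - 1 / s * deriv ψ (PoissonStein.ya lam n)
      - (1 / s) ^ 2 / 2 * iteratedDeriv 2 ψ (PoissonStein.ya lam n)) (C := M * (1 / s) ^ 3 / 6)
    (Filter.Eventually.of_forall fun n => tay (PoissonStein.ya lam n))
  simp only [probReal_univ, mul_one, Real.norm_eq_abs] at hR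
  have hsplit : ∫ n, (ψ (PoissonStein.ya lam n + 1 / s) - ψ (PoissonStein.ya lam n)
      - 1 / s * deriv ψ (PoissonStein.ya lam n)) ∂(poissonMeasure lam) =
      (∫ n, (ψ (PoissonStein.ya lam n + 1 / s) - ψ (PoissonStein.ya lam n)
      - 1 / s * deriv ψ (PoissonStein.ya lam n)
      - (1 / s) ^ 2 / 2 * iteratedDeriv 2 ψ (PoissonStein.ya lam n)) ∂(poissonMeasure lam))
      + (1 / s) ^ 2 / 2 * ∫ n, iteratedDeriv 2 ψ (PoissonStein.ya lam n) ∂(poissonMeasure lam) := by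
    rw [← integral_const_mul, ← integral_add iR (iG.const_mul _)]
    congr 1; ext n; ring
  rw [hF2, hsplit]
  set R := ∫ n, (ψ (PoissonStein.ya lam n + 1 / s) - ψ (PoissonStein.ya lam n)
      - 1 / s * deriv ψ (PoissonStein.ya lam n)
      - (1 / s) ^ 2 / 2 * iteratedDeriv 2 ψ (PoissonStein.ya lam n)) ∂(poissonMeasure lam)
  set T := ∫ n, iteratedDeriv 2 ψ (PoissonStein.ya lam n) ∂(poissonMeasure lam)
  have e : s * (R + (1 / s) ^ 2 / 2 * T) - 1 / (2 * s) * cG = s * R + 1 / (2 * s) * (T - cG) := by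
    field_simp
    ring
  rw [e, ← hss]
  have b1 : |s * R| ≤ M / (s * s) / 6 := by
    rw [abs_mul, abs_of_pos hs]
    refine (mul_le_mul_of_nonneg_left hR hs.le).trans (le_of_eq ?_)
    field_simp
  have b2 : |1 / (2 * s) * (T - cG)| ≤ M / (s * s) / 2 := by
    rw [abs_mul, abs_of_pos (by positivity : (0 : ℝ) < 1 / (2 * s))]
    refine (mul_le_mul_of_nonneg_left hG (by positivity)).trans (le_of_eq ?_)
    field_simp
  have b3 : 0 ≤ M / (s * s) := by positivity
  calc _ ≤ _ := abs_add_le _ _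
    _ ≤ M / (s * s) := by linarith
end

section
/- Let X_λ be a random variable with the Poisson distribution of parameter λ on ℕ and set X̃_λ = (X_λ − λ)/√λ. Let F : ℝ → ℝ be three times continuously differentiable with F, F′, F″, F‴ bounded. Then there exists a constant C ≥ 0 (depending only on F) such that for all λ ≥ 1: | E[F(X̃_λ)] − ∫_ℝ F dγ − (1/(6√λ)) ∫_ℝ F(x) H₃(x) dγ(x) | ≤ C/λ, where H₃(x) = x³ − 3x. This is the first-order Edgeworth expansion for the normal approximation of the normalized Poisson distribution. -/
open MeasureTheory Real ProbabilityTheory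

section Aux

open Filter Topology

lemma hasDerivAt_ge (x : ℝ) :
    HasDerivAt (fun x : ℝ => Real.exp (-(x ^ 2 / 2))) (-x * Real.exp (-(x ^ 2 / 2))) x := by
  have h : HasDerivAt (fun x : ℝ => -(x ^ 2 / 2)) (-x) x := by
    have := ((hasDerivAt_pow 2 x).div_const 2).neg
    convert! this using 1
    simp
  convert! h.exp using 1
  ring

lemma tendsto_ge_atTop :
    Tendsto (fun x : ℝ => Real.exp (-(x ^ 2 / 2))) atTop (𝓝 0) := by
  apply Real.tendsto_exp_atBot.comp
  apply tendsto_neg_atTop_atBot.comp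
  exact (tendsto_pow_atTop (by norm_num)).atTop_div_const (by norm_num)

lemma tendsto_ge_atBot :
    Tendsto (fun x : ℝ => Real.exp (-(x ^ 2 / 2))) atBot (𝓝 0) := by
  have := tendsto_ge_atTop.comp tendsto_neg_atBot_atTop
  refine this.congr fun x => ?_
  simp

lemma apriori_core {u R : ℝ → ℝ} {M : ℝ} (hM : ∀ x, |R x| ≤ M)
    (hu : ∀ x, HasDerivAt u (x * u x + R x) x)
    (ht : Tendsto (fun x => u x * Real.exp (-(x ^ 2 / 2))) atTop (𝓝 0)) {x : ℝ} (hx : 0 < x) :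
    x * u x ≤ M := by
  have hM0 : 0 ≤ M := (abs_nonneg _).trans (hM 0)
  have hd : ∀ y, HasDerivAt (fun y => (u y - M / x) * Real.exp (-(y ^ 2 / 2)))
      ((R y + y * (M / x)) * Real.exp (-(y ^ 2 / 2))) y := by
    intro y
    convert! ((hu y).sub_const (M / x)).mul (hasDerivAt_ge y) using 1
    ring
  have hmono : MonotoneOn (fun y => (u y - M / x) * Real.exp (-(y ^ 2 / 2))) (Set.Ici x) := by
    refine monotoneOn_of_hasDerivWithinAt_nonneg (convex_Ici x)
      (fun y _ => (hd y).continuousAt.continuousWithinAt)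
      (fun y _ => (hd y).hasDerivWithinAt) ?_
    intro y hy
    rw [interior_Ici] at hy
    have hxy : x < y := hy
    have h1 : M ≤ y * (M / x) := by
      rw [mul_div_assoc', le_div_iff₀ hx]
      nlinarith
    have h2 := (abs_le.1 (hM y)).1
    have : 0 ≤ R y + y * (M / x) := by linarith
    positivity
  have hlim : Tendsto (fun y => (u y - M / x) * Real.exp (-(y ^ 2 / 2))) atTop (𝓝 0) := by
    have := ht.sub (tendsto_ge_atTop.const_mul (M / x))
    simp only [mul_zero, sub_zero] at this
    exact this.congr fun y => by ring
  have h0 : (u x - M / x) * Real.exp (-(x ^ 2 / 2)) ≤ 0 := by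
    refine ge_of_tendsto hlim ?_
    filter_upwards [eventually_ge_atTop x] with y hy
    exact hmono Set.self_mem_Ici hy hy
  have h1 : u x - M / x ≤ 0 := by
    by_contra hc
    push Not at hc
    have := mul_pos hc (Real.exp_pos (-(x ^ 2 / 2)))
    linarith
  have h2 : u x ≤ M / x := by linarith
  rw [le_div_iff₀ hx] at h2
  linarith

lemma apriori_pos {u R : ℝ → ℝ} {M : ℝ} (hM : ∀ x, |R x| ≤ M)
    (hu : ∀ x, HasDerivAt u (x * u x + R x) x)
    (ht : Tendsto (fun x => u x * Real.exp (-(x ^ 2 / 2))) atTop (𝓝 0)) {x : ℝ} (hx : 0 < x) :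
    |x * u x| ≤ M := by
  have h1 := apriori_core hM hu ht hx
  have h2 := apriori_core (u := fun y => - u y) (R := fun y => - R y) (M := M)
    (fun y => by rw [abs_neg]; exact hM y)
    (fun y => by convert! (hu y).neg using 1; ring)
    (by simpa using ht.neg) hx
  rw [abs_le]
  constructor <;> linarith

lemma apriori {u R : ℝ → ℝ} {M : ℝ} (hM : ∀ x, |R x| ≤ M)
    (hu : ∀ x, HasDerivAt u (x * u x + R x) x)
    (ht : Tendsto (fun x => u x * Real.exp (-(x ^ 2 / 2))) atTop (𝓝 0))
    (hb : Tendsto (fun x => u x * Real.exp (-(x ^ 2 / 2))) atBot (𝓝 0)) (x : ℝ) :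
    |x * u x| ≤ M := by
  rcases lt_trichotomy x 0 with hx | hx | hx
  · have := apriori_pos (u := fun y => u (-y)) (R := fun y => - R (-y)) (M := M)
      (fun y => by rw [abs_neg]; exact hM _)
      (fun y => by
        have := (hu (-y)).comp y (hasDerivAt_neg y)
        convert! this using 1
        ring)
      (by
        have := hb.comp tendsto_neg_atTop_atBot
        refine this.congr fun y => ?_
        simp) (neg_pos.2 hx)
    simpa using this
  · subst hx
    simpa using (abs_nonneg _).trans (hM 0)
  · exact apriori_pos hM hu ht hx

lemma apriori_bdd {u R : ℝ → ℝ} {M B : ℝ} (hM : ∀ x, |R x| ≤ M)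
    (hu : ∀ x, HasDerivAt u (x * u x + R x) x) (hB : ∀ x, |u x| ≤ B) (x : ℝ) :
    |x * u x + R x| ≤ 2 * M := by
  have key : ∀ l : Filter ℝ, Tendsto (fun x : ℝ => Real.exp (-(x ^ 2 / 2))) l (𝓝 0) →
      Tendsto (fun x => u x * Real.exp (-(x ^ 2 / 2))) l (𝓝 0) := by
    intro l hl
    refine squeeze_zero_norm (fun y => ?_) (by simpa using hl.const_mul B)
    rw [norm_mul, Real.norm_eq_abs, Real.norm_eq_abs, abs_of_pos (Real.exp_pos _)]
    exact mul_le_mul_of_nonneg_right (hB y) (Real.exp_pos _).le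
  have := apriori hM hu (key _ tendsto_ge_atTop) (key _ tendsto_ge_atBot) x
  calc _ ≤ |x * u x| + |R x| := abs_add_le _ _
    _ ≤ M + M := add_le_add this (hM x)
    _ = _ := by ring

lemma integrable_gauss {w : ℝ → ℝ} (hw : Continuous w) {K : ℝ}
    (hK : ∀ x, |w x| ≤ K * (1 + x ^ 4)) : Integrable w (gaussianReal 0 1) := by
  have h4 : Integrable (fun x : ℝ => x ^ 4) (gaussianReal 0 1) := by
    have := (memLp_id_gaussianReal (μ := 0) (v := 1) 4).integrable_norm_pow (by norm_num)
    refine this.congr (ae_of_all _ fun x => ?_)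
    simp only [id, Real.norm_eq_abs]
    exact Even.pow_abs (by decide) x
  refine Integrable.mono' (((integrable_const 1).add h4).const_mul K) hw.aestronglyMeasurable
    (ae_of_all _ fun x => ?_)
  simpa using hK x

lemma pdf_eq (x : ℝ) : gaussianPDFReal 0 1 x = (√(2 * π))⁻¹ * Real.exp (-(x ^ 2 / 2)) := by
  simp only [gaussianPDFReal, NNReal.coe_one, mul_one, sub_zero]
  congr 2
  ring

lemma integral_gauss (w : ℝ → ℝ) :
    ∫ x, w x ∂(gaussianReal 0 1) = (√(2 * π))⁻¹ * ∫ x, w x * Real.exp (-(x ^ 2 / 2)) := by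
  rw [integral_gaussianReal_eq_integral_smul (by norm_num), ← integral_const_mul]
  congr 1
  ext x
  rw [pdf_eq, smul_eq_mul]
  ring

lemma integrable_ge {w : ℝ → ℝ} (hw : Continuous w) {K : ℝ}
    (hK : ∀ x, |w x| ≤ K * (1 + x ^ 4)) :
    Integrable (fun x => w x * Real.exp (-(x ^ 2 / 2))) := by
  have h0 : Integrable (fun x : ℝ => Real.exp (-(x ^ 2 / 2))) := by
    have := integrable_exp_neg_mul_sq (b := 1 / 2) (by norm_num)
    refine this.congr (ae_of_all _ fun x => ?_)
    simp only []
    congr 1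
    ring
  have h4 : Integrable (fun x : ℝ => x ^ 4 * Real.exp (-(x ^ 2 / 2))) := by
    have := integrable_rpow_mul_exp_neg_mul_sq (b := 1 / 2) (by norm_num)
      (s := (4 : ℕ)) (by norm_num)
    refine this.congr (ae_of_all _ fun x => ?_)
    simp only [Real.rpow_natCast]
    congr 2
    ring
  refine Integrable.mono' ((h0.add h4).const_mul K) (by fun_prop) (ae_of_all _ fun x => ?_)
  rw [norm_mul, Real.norm_eq_abs, Real.norm_eq_abs, abs_of_pos (Real.exp_pos _)]
  calc _ ≤ K * (1 + x ^ 4) * Real.exp (-(x ^ 2 / 2)) :=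
        mul_le_mul_of_nonneg_right (hK x) (Real.exp_pos _).le
    _ = _ := by simp only [Pi.add_apply]; ring

/-- Gaussian integration by parts. -/
lemma gauss_ibp {u v : ℝ → ℝ} (hu : ∀ x, HasDerivAt u (v x + x * u x) x) (hv : Continuous v)
    {K : ℝ} (hK : ∀ x, |u x| ≤ K * (1 + x ^ 4)) {K' : ℝ} (hK' : ∀ x, |v x| ≤ K' * (1 + x ^ 4)) :
    ∫ x, v x ∂(gaussianReal 0 1) = 0 := by
  have huc : Continuous u := continuous_iff_continuousAt.2 fun x => (hu x).continuousAt
  rw [integral_gauss, integral_eq_zero_of_hasDerivAt_of_integrable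
    (f := fun x => u x * Real.exp (-(x ^ 2 / 2))) _ (integrable_ge hv hK') (integrable_ge huc hK),
    mul_zero]
  intro x
  convert! (hu x).mul (hasDerivAt_ge x) using 1
  ring

/-- Bounded solution of the Stein equation. -/
lemma stein_exists {F : ℝ → ℝ} (hF : Continuous F) {B : ℝ} (hB : ∀ x, |F x| ≤ B) :
    ∃ f : ℝ → ℝ, (∃ K, ∀ x, |f x| ≤ K) ∧
      ∀ x, HasDerivAt f (x * f x + (F x - ∫ y, F y ∂(gaussianReal 0 1))) x := by
  set c := ∫ y, F y ∂(gaussianReal 0 1) with hc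
  have hB0 : 0 ≤ B := (abs_nonneg _).trans (hB 0)
  have hR : ∀ x, |F x - c| ≤ B + |c| := fun x =>
    (abs_sub _ _).trans (add_le_add (hB x) le_rfl)
  have hR' : ∀ x : ℝ, |F x - c| ≤ (B + |c|) * (1 + x ^ 4) := fun x => by
    refine (hR x).trans ?_
    have : 0 ≤ B + |c| := by positivity
    have : 0 ≤ x ^ 4 := by positivity
    nlinarith
  have hFI : Integrable F (gaussianReal 0 1) := by
    refine integrable_gauss hF (K := B) fun x => (hB x).trans ?_
    have : 0 ≤ x ^ 4 := by positivity
    nlinarith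
  set q : ℝ → ℝ := fun x => (F x - c) * Real.exp (-(x ^ 2 / 2)) with hq
  have hqc : Continuous q := by fun_prop
  have hqi : Integrable q := integrable_ge (w := fun x => F x - c) (by fun_prop) hR'
  have hq0 : ∫ x, q x = 0 := by
    have h1 : ∫ x, (F x - c) ∂(gaussianReal 0 1) = 0 := by
      rw [integral_sub hFI (integrable_const _)]
      simp [hc]
    rw [integral_gauss] at h1
    rcases mul_eq_zero.1 h1 with h | h
    · have : (√(2 * π))⁻¹ ≠ 0 := by positivity
      exact absurd h this
    · exact h
  set A := ∫ x in Set.Ioi 0, q x with hA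
  have hA' : ∫ x in Set.Iic 0, q x = - A := by
    have := intervalIntegral.integral_Iic_add_Ioi (b := 0) hqi.integrableOn hqi.integrableOn
    rw [hq0] at this
    linarith
  set I : ℝ → ℝ := fun x => (∫ t in (0 : ℝ)..x, q t) - A with hI
  have hId : ∀ x, HasDerivAt I (q x) x := fun x =>
    (intervalIntegral.integral_hasDerivAt_right (hqc.intervalIntegrable _ _)
      (hqc.stronglyMeasurableAtFilter _ _) hqc.continuousAt).sub_const A
  have hIt : Tendsto I atTop (𝓝 0) := by
    have := (intervalIntegral_tendsto_integral_Ioi (0 : ℝ) hqi.integrableOn tendsto_id).sub_const A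
    simpa [hI, hA] using this
  have hIb : Tendsto I atBot (𝓝 0) := by
    have := ((intervalIntegral_tendsto_integral_Iic (0 : ℝ) hqi.integrableOn
      tendsto_id).neg).sub_const A
    rw [hA'] at this
    simp only [neg_neg, sub_self] at this
    refine this.congr fun x => ?_
    simp only [hI, id]
    rw [intervalIntegral.integral_symm]
    ring
  have hcan : ∀ x : ℝ, Real.exp (x ^ 2 / 2) * Real.exp (-(x ^ 2 / 2)) = 1 := fun x => by
    rw [← Real.exp_add]; simp
  set f : ℝ → ℝ := fun x => I x * Real.exp (x ^ 2 / 2) with hf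
  have hfe : ∀ x, f x * Real.exp (-(x ^ 2 / 2)) = I x := fun x => by
    simp only [hf]
    rw [mul_assoc, hcan, mul_one]
  have hfd : ∀ x, HasDerivAt f (x * f x + (F x - c)) x := by
    intro x
    have he : HasDerivAt (fun x : ℝ => Real.exp (x ^ 2 / 2)) (Real.exp (x ^ 2 / 2) * x) x := by
      have h : HasDerivAt (fun x : ℝ => x ^ 2 / 2) x x := by
        have := ((hasDerivAt_pow 2 x).div_const 2)
        convert! this using 1
        simp
      exact h.exp
    convert! (hId x).mul he using 1
    simp only [hf, hq]
    linear_combination (-(F x - c)) * hcan x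
  refine ⟨f, ?_, hfd⟩
  have hap := apriori hR hfd (by simpa only [hfe] using hIt) (by simpa only [hfe] using hIb)
  have hfc : Continuous f := continuous_iff_continuousAt.2 fun x => (hfd x).continuousAt
  obtain ⟨K, hK⟩ := (isCompact_Icc (a := (-1 : ℝ)) (b := 1)).exists_bound_of_continuousOn
    hfc.continuousOn
  refine ⟨max K (B + |c|), fun x => ?_⟩
  by_cases hx : |x| ≤ 1
  · exact (hK x (abs_le.1 hx)).trans (le_max_left _ _)
  · push Not at hx
    refine le_trans ?_ ((hap x).trans (le_max_right _ _))
    have h3 := mul_le_mul_of_nonneg_right hx.le (abs_nonneg (f x))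
    rw [one_mul, ← abs_mul] at h3
    exact h3

lemma taylor_one {f f1 f2 : ℝ → ℝ} (h0 : ∀ x, HasDerivAt f (f1 x) x)
    (h1 : ∀ x, HasDerivAt f1 (f2 x) x) {M : ℝ} (hM : ∀ x, |f2 x| ≤ M) (x : ℝ) {h : ℝ}
    (hh : 0 ≤ h) : |f (x + h) - f x - h * f1 x| ≤ M * h ^ 2 := by
  have hM0 : 0 ≤ M := (abs_nonneg _).trans (hM 0)
  have hs : ∀ {g g1 : ℝ → ℝ} (_ : ∀ x, HasDerivAt g (g1 x) x) (t : ℝ),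
      HasDerivAt (fun t => g (x + t)) (g1 (x + t)) t := by
    intro g g1 hg t
    exact (hg (x + t)).comp_const_add x t
  have hA : ∀ t ∈ Set.Icc 0 h, |f1 (x + t) - f1 x| ≤ M * h := by
    intro t ht
    have := norm_image_sub_le_of_norm_deriv_le_segment' (a := 0) (b := h)
      (fun s _ => (hs h1 s).hasDerivWithinAt) (fun s _ => hM _) t ht
    simp only [add_zero, sub_zero, Real.norm_eq_abs] at this
    exact this.trans (mul_le_mul_of_nonneg_left ht.2 hM0)
  have := norm_image_sub_le_of_norm_deriv_le_segment' (a := 0) (b := h)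
      (f := fun t => f (x + t) - t * f1 x) (f' := fun t => f1 (x + t) - f1 x) (C := M * h)
      (fun s _ => by
        have := ((hs h0 s).sub ((hasDerivAt_id s).mul_const (f1 x))).hasDerivWithinAt
          (s := Set.Icc 0 h)
        simp only [one_mul] at this
        exact this)
      (fun s hs => hA s ⟨hs.1, hs.2.le⟩) h ⟨hh, le_rfl⟩
  simp only [add_zero, sub_zero, Real.norm_eq_abs, zero_mul] at this
  calc _ = |f (x + h) - h * f1 x - f x| := by congr 1; ring
    _ ≤ _ := this
    _ = _ := by ring

lemma taylor_two {f f1 f2 f3 : ℝ → ℝ} (h0 : ∀ x, HasDerivAt f (f1 x) x)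
    (h1 : ∀ x, HasDerivAt f1 (f2 x) x) (h2 : ∀ x, HasDerivAt f2 (f3 x) x)
    {M : ℝ} (hM : ∀ x, |f3 x| ≤ M) (x : ℝ) {h : ℝ}
    (hh : 0 ≤ h) : |f (x + h) - f x - h * f1 x - h ^ 2 / 2 * f2 x| ≤ M * h ^ 3 := by
  have hM0 : 0 ≤ M := (abs_nonneg _).trans (hM 0)
  have := norm_image_sub_le_of_norm_deriv_le_segment' (a := 0) (b := h)
      (f := fun t => f (x + t) - t * f1 x - t ^ 2 / 2 * f2 x)
      (f' := fun t => f1 (x + t) - f1 x - t * f2 x) (C := M * h ^ 2)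
      (fun s _ => by
        have hp : HasDerivAt (fun x : ℝ => x ^ 2 / 2) s s := by
          have := ((hasDerivAt_pow 2 s).div_const 2)
          convert! this using 1
          simp
        have := ((((h0 (x + s)).comp_const_add x s).sub
          ((hasDerivAt_id s).mul_const (f1 x))).sub (hp.mul_const (f2 x))).hasDerivWithinAt
          (s := Set.Icc 0 h)
        simp only [one_mul] at this
        exact this)
      (fun s hs => (taylor_one h1 h2 hM x hs.1).trans
        (mul_le_mul_of_nonneg_left (pow_le_pow_left₀ hs.1 hs.2.le 2) hM0)) h ⟨hh, le_rfl⟩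
  simp only [add_zero, sub_zero, Real.norm_eq_abs, zero_mul] at this
  calc _ = |f (x + h) - h * f1 x - h ^ 2 / 2 * f2 x - f x| := by congr 1; ring
    _ ≤ |f (x + h) - h * f1 x - h ^ 2 / 2 * f2 x - (f x - 0 ^ 2 / 2 * f2 x)| := by
        apply le_of_eq; congr 1; ring
    _ ≤ _ := this
    _ = _ := by ring

lemma integrable_po {r : NNReal} {g : ℕ → ℝ} {B : ℝ} (hB : ∀ k, |g k| ≤ B) :
    Integrable g (poissonMeasure r) :=
  Integrable.of_bound (by fun_prop) B (ae_of_all _ hB)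

lemma po_shift {r : NNReal} {g : ℕ → ℝ} {B : ℝ} (hB : ∀ k, |g k| ≤ B) :
    Integrable (fun k : ℕ => (k : ℝ) * g k) (poissonMeasure r) ∧
    ∫ k : ℕ, (k : ℝ) * g k ∂(poissonMeasure r) = r * ∫ k : ℕ, g (k + 1) ∂(poissonMeasure r) := by
  have key : ∀ (g : ℕ → ℝ) (n : ℕ), (Real.exp (-r) * r ^ (n + 1) / ((n + 1).factorial : ℝ)) *
      (((n + 1 : ℕ) : ℝ) * g (n + 1)) =
      r * ((Real.exp (-r) * r ^ n / (n.factorial : ℝ)) * g (n + 1)) := by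
    intro g n
    rw [Nat.factorial_succ]
    push_cast
    have h1 : (n.factorial : ℝ) ≠ 0 := by positivity
    have h2 : (n : ℝ) + 1 ≠ 0 := by positivity
    field_simp
    ring
  have hi : Integrable (fun k => g (k + 1)) (poissonMeasure r) := integrable_po (fun k => hB (k + 1))
  have hI : Integrable (fun k : ℕ => (k : ℝ) * g k) (poissonMeasure r) := by
    rw [integrable_poissonMeasure_iff] at hi ⊢
    rw [← summable_nat_add_iff 1]
    refine (hi.mul_left (r : ℝ)).congr fun n => ?_
    have := key (fun k => |g k|) n
    simp only [Real.norm_eq_abs, abs_mul, Nat.abs_cast]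
    rw [this]
  refine ⟨hI, ?_⟩
  have h1 := (hasSum_integral_poissonMeasure hi).mul_left (r : ℝ)
  have h2 := hasSum_integral_poissonMeasure hI
  rw [← hasSum_nat_add_iff' 1] at h2
  simp only [smul_eq_mul, Finset.range_one, Finset.sum_singleton, Nat.cast_zero, zero_mul,
    mul_zero, sub_zero] at h1 h2
  refine h2.unique ?_
  convert! h1 using 1
  ext n
  exact key g n

lemma po_stein {f : ℝ → ℝ} {B : ℝ} (hB : ∀ x, |f x| ≤ B) {r : NNReal} {s : ℝ} (hs : 0 < s)
    (hsr : s ^ 2 = r) :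
    Integrable (fun k : ℕ => ((k : ℝ) - r) / s * f (((k : ℝ) - r) / s)) (poissonMeasure r) ∧
    ∫ k : ℕ, ((k : ℝ) - r) / s * f (((k : ℝ) - r) / s) ∂(poissonMeasure r) =
    ∫ k : ℕ, s * (f (((k : ℝ) - r) / s + 1 / s) - f (((k : ℝ) - r) / s)) ∂(poissonMeasure r) := by
  obtain ⟨h1, h2⟩ := po_shift (r := r) (g := fun k : ℕ => f (((k : ℝ) - r) / s)) (fun k => hB _)
  have h3 : Integrable (fun k : ℕ => f (((k : ℝ) - r) / s)) (poissonMeasure r) :=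
    integrable_po (fun k => hB _)
  have h4 : Integrable (fun k : ℕ => f (((k : ℝ) - r) / s + 1 / s)) (poissonMeasure r) :=
    integrable_po (fun k => hB _)
  have e : (fun k : ℕ => ((k : ℝ) - r) / s * f (((k : ℝ) - r) / s)) =
      fun k : ℕ => (1 / s) * ((k : ℝ) * f (((k : ℝ) - r) / s) - r * f (((k : ℝ) - r) / s)) := by
    ext k; ring
  have e2 : ∀ k : ℕ, (((k + 1 : ℕ) : ℝ) - r) / s = ((k : ℝ) - r) / s + 1 / s := by
    intro k; push_cast; ring
  simp only [e2] at h2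
  rw [e]
  refine ⟨(h1.sub (h3.const_mul _)).const_mul _, ?_⟩
  rw [integral_const_mul, integral_const_mul, integral_sub h1 (h3.const_mul _), h2,
    integral_const_mul, integral_sub h4 h3, ← hsr]
  field_simp

/-- The Stein identity for the normalized Poisson law. -/
lemma po_main {F f : ℝ → ℝ} {c B B' : ℝ} (hF : ∀ x, |F x| ≤ B') (hB : ∀ x, |f x| ≤ B)
    {r : NNReal} {s : ℝ} (hs : 0 < s) (hsr : s ^ 2 = r) :
    (∫ k : ℕ, F (((k : ℝ) - r) / s) ∂(poissonMeasure r)) - c =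
    ∫ k : ℕ, ((((k : ℝ) - r) / s) * f (((k : ℝ) - r) / s) + (F (((k : ℝ) - r) / s) - c)
      - s * (f (((k : ℝ) - r) / s + 1 / s) - f (((k : ℝ) - r) / s))) ∂(poissonMeasure r) := by
  obtain ⟨h1, h2⟩ := po_stein hB hs hsr
  have h3 : Integrable (fun k : ℕ => f (((k : ℝ) - r) / s)) (poissonMeasure r) :=
    integrable_po (fun k => hB _)
  have h4 : Integrable (fun k : ℕ => f (((k : ℝ) - r) / s + 1 / s)) (poissonMeasure r) :=
    integrable_po (fun k => hB _)
  have h5 : Integrable (fun k : ℕ => F (((k : ℝ) - r) / s)) (poissonMeasure r) :=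
    integrable_po (fun k => hF _)
  have h6 : Integrable (fun k : ℕ => F (((k : ℝ) - r) / s) - c) (poissonMeasure r) :=
    h5.sub (integrable_const c)
  have h7 : Integrable (fun k : ℕ => ((k : ℝ) - r) / s * f (((k : ℝ) - r) / s)
      + (F (((k : ℝ) - r) / s) - c)) (poissonMeasure r) := h1.add h6
  have h8 : Integrable (fun k : ℕ => s * (f (((k : ℝ) - r) / s + 1 / s)
      - f (((k : ℝ) - r) / s))) (poissonMeasure r) := (h4.sub h3).const_mul s
  rw [integral_sub h7 h8, integral_add h1 h6, h2, integral_sub h5 (integrable_const c)]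
  simp

lemma gauss_H3 {F f f2 : ℝ → ℝ} {c B0 B1 B2 B : ℝ} (hFc : Continuous F) (hf2c : Continuous f2)
    (hF : ∀ x, |F x| ≤ B)
    (h0 : ∀ x, HasDerivAt f (x * f x + (F x - c)) x)
    (h1 : ∀ x, HasDerivAt (fun x => x * f x + (F x - c)) (f2 x) x)
    (b0 : ∀ x, |f x| ≤ B0) (b1 : ∀ x, |x * f x + (F x - c)| ≤ B1) (b2 : ∀ x, |f2 x| ≤ B2) :
    ∫ x, f2 x ∂(gaussianReal 0 1) = -(1 / 3) * ∫ x, F x * (x ^ 3 - 3 * x) ∂(gaussianReal 0 1) := by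
  have p3 : ∀ x : ℝ, |x ^ 3| ≤ 1 + x ^ 4 := fun x => by
    rw [abs_le]
    constructor <;> nlinarith [sq_nonneg (x ^ 2 + x), sq_nonneg (x ^ 2 - x), sq_nonneg (x - 1),
      sq_nonneg (x + 1), sq_nonneg (x ^ 2 - 1), sq_nonneg (x^2)]
  have p1 : ∀ x : ℝ, |x| ≤ 1 + x ^ 4 := fun x => by
    rw [abs_le]
    constructor <;> nlinarith [sq_nonneg (x - 1), sq_nonneg (x + 1), sq_nonneg (x ^ 2 - 1),
      sq_nonneg (x^2)]
  have p2 : ∀ x : ℝ, |x ^ 2 - 1| ≤ 1 + x ^ 4 := fun x => by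
    rw [abs_le]
    constructor <;> nlinarith [sq_nonneg (x ^ 2 - 1), sq_nonneg x, sq_nonneg (x^2)]
  have p0 : ∀ x : ℝ, 1 ≤ 1 + x ^ 4 := fun x => by
    have : 0 ≤ x ^ 4 := by positivity
    linarith
  have hB : 0 ≤ B := (abs_nonneg _).trans (hF 0)
  have hB0 : 0 ≤ B0 := (abs_nonneg _).trans (b0 0)
  have hB1 : 0 ≤ B1 := (abs_nonneg _).trans (b1 0)
  have hB2 : 0 ≤ B2 := (abs_nonneg _).trans (b2 0)
  have bF : ∀ x, |F x * (x ^ 3 - 3 * x)| ≤ 4 * B * (1 + x ^ 4) := fun x => by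
    rw [abs_mul]
    have : |x ^ 3 - 3 * x| ≤ 4 * (1 + x ^ 4) := by
      have := abs_sub (x ^ 3) (3 * x)
      rw [abs_mul, abs_of_pos (by norm_num : (0 : ℝ) < 3)] at this
      linarith [p1 x, p3 x]
    calc _ ≤ B * (4 * (1 + x ^ 4)) := mul_le_mul (hF x) this (abs_nonneg _) hB
      _ = _ := by ring
  have bf2 : ∀ x, |3 * f2 x| ≤ 3 * B2 * (1 + x ^ 4) := fun x => by
    rw [abs_mul, abs_of_pos (by norm_num : (0 : ℝ) < 3)]
    nlinarith [b2 x, p0 x]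
  have iF : Integrable (fun x => F x * (x ^ 3 - 3 * x)) (gaussianReal 0 1) :=
    integrable_gauss (by fun_prop) bF
  have if2 : Integrable (fun x => 3 * f2 x) (gaussianReal 0 1) :=
    integrable_gauss (by fun_prop) bf2
  have key : ∫ x, (F x * (x ^ 3 - 3 * x) + 3 * f2 x) ∂(gaussianReal 0 1) = 0 := by
    refine gauss_ibp (u := fun x => f x * x ^ 3 + 3 * (x * f x + (F x - c)) - c * (x ^ 2 - 1))
      ?_ (by fun_prop) (K := B0 + 3 * B1 + |c|) ?_ (K' := 4 * B + 3 * B2) ?_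
    · intro x
      have := (((h0 x).mul (hasDerivAt_pow 3 x)).add ((h1 x).const_mul 3)).sub
        (((hasDerivAt_pow 2 x).sub_const 1).const_mul c)
      convert! this using 1
      simp
      ring
    · intro x
      have e1 : |f x * x ^ 3| ≤ B0 * (1 + x ^ 4) := by
        rw [abs_mul]; exact mul_le_mul (b0 x) (p3 x) (abs_nonneg _) hB0
      have e2 : |3 * (x * f x + (F x - c))| ≤ 3 * B1 * (1 + x ^ 4) := by
        rw [abs_mul, abs_of_pos (by norm_num : (0 : ℝ) < 3)]
        nlinarith [b1 x, p0 x]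
      have e3 : |c * (x ^ 2 - 1)| ≤ |c| * (1 + x ^ 4) := by
        rw [abs_mul]; exact mul_le_mul_of_nonneg_left (p2 x) (abs_nonneg _)
      have e4 := abs_sub (f x * x ^ 3 + 3 * (x * f x + (F x - c))) (c * (x ^ 2 - 1))
      have e5 := abs_add_le (f x * x ^ 3) (3 * (x * f x + (F x - c)))
      calc _ ≤ _ := e4
        _ ≤ B0 * (1 + x ^ 4) + 3 * B1 * (1 + x ^ 4) + |c| * (1 + x ^ 4) := by linarith
        _ = _ := by ring
    · intro x
      have := abs_add_le (F x * (x ^ 3 - 3 * x)) (3 * f2 x)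
      linarith [bF x, bf2 x]
  rw [integral_add iF if2, integral_const_mul] at key
  linarith

lemma abs_integral_po_le {r : NNReal} {g : ℕ → ℝ} {B : ℝ} (hB : ∀ k, |g k| ≤ B) :
    |∫ k, g k ∂(poissonMeasure r)| ≤ B := by
  have := norm_integral_le_of_norm_le_const (μ := poissonMeasure r) (f := g) (C := B)
    (ae_of_all _ hB)
  simpa using this

lemma edgeworth_aux {F F1 F2 : ℝ → ℝ} (d0 : ∀ x, HasDerivAt F (F1 x) x)
    (d1 : ∀ x, HasDerivAt F1 (F2 x) x) {A0 A1 A2 : ℝ} (a0 : ∀ x, |F x| ≤ A0)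
    (a1 : ∀ x, |F1 x| ≤ A1) (a2 : ∀ x, |F2 x| ≤ A2) :
    ∃ C : ℝ, 0 ≤ C ∧ ∀ lam : NNReal, 1 ≤ lam →
      |(∫ k : ℕ, F (((k : ℝ) - lam) / Real.sqrt lam) ∂(poissonMeasure lam))
          - (∫ x, F x ∂(gaussianReal 0 1))
          - (1 / (6 * Real.sqrt lam)) *
              ∫ x, F x * (x ^ 3 - 3 * x) ∂(gaussianReal 0 1)|
        ≤ C / lam := by
  have hFc : Continuous F := continuous_iff_continuousAt.2 fun x => (d0 x).continuousAt
  obtain ⟨f, ⟨B0, b0⟩, h0⟩ := stein_exists hFc a0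
  set c := ∫ x, F x ∂(gaussianReal 0 1) with hc
  have aR : ∀ x, |F x - c| ≤ A0 + |c| := fun x => (abs_sub _ _).trans (add_le_add (a0 x) le_rfl)
  have b1 := apriori_bdd aR h0 b0
  -- first derivative of `f`
  set f1 : ℝ → ℝ := fun x => x * f x + (F x - c) with hf1
  have h1 : ∀ x, HasDerivAt f1 (x * f1 x + (f x + F1 x)) x := by
    intro x
    have := ((hasDerivAt_id x).mul (h0 x)).add ((d0 x).sub_const c)
    convert! this using 1
    simp only [id, hf1]
    ring
  have aR1 : ∀ x, |f x + F1 x| ≤ B0 + A1 := fun x =>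
    (abs_add_le _ _).trans (add_le_add (b0 x) (a1 x))
  have b2 := apriori_bdd aR1 h1 b1
  set f2 : ℝ → ℝ := fun x => x * f1 x + (f x + F1 x) with hf2
  have h2 : ∀ x, HasDerivAt f2 (x * f2 x + (2 * f1 x + F2 x)) x := by
    intro x
    have := ((hasDerivAt_id x).mul (h1 x)).add ((h0 x).add (d1 x))
    convert! this using 1
    simp only [id, hf2, hf1]
    ring
  have aR2 : ∀ x, |2 * f1 x + F2 x| ≤ 2 * (2 * (A0 + |c|)) + A2 := fun x => by
    refine (abs_add_le _ _).trans (add_le_add ?_ (a2 x))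
    rw [abs_mul, abs_of_pos (by norm_num : (0 : ℝ) < 2)]
    linarith [b1 x]
  have b3 := apriori_bdd aR2 h2 b2
  set f3 : ℝ → ℝ := fun x => x * f2 x + (2 * f1 x + F2 x) with hf3
  have hf2c : Continuous f2 := continuous_iff_continuousAt.2 fun x => (h2 x).continuousAt
  have hm := gauss_H3 hFc hf2c a0 h0 h1 b0 b1 b2
  -- the Stein solution for `f2`
  obtain ⟨g, ⟨D0, e0⟩, k0⟩ := stein_exists hf2c b2
  set m := ∫ x, f2 x ∂(gaussianReal 0 1) with hmdef
  have cR : ∀ x, |f2 x - m| ≤ 2 * (B0 + A1) + |m| := fun x =>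
    (abs_sub _ _).trans (add_le_add (b2 x) le_rfl)
  have e1 := apriori_bdd cR k0 e0
  set g1 : ℝ → ℝ := fun x => x * g x + (f2 x - m) with hg1
  have k1 : ∀ x, HasDerivAt g1 (x * g1 x + (g x + f3 x)) x := by
    intro x
    have := ((hasDerivAt_id x).mul (k0 x)).add ((h2 x).sub_const m)
    convert! this using 1
    simp only [id, hg1, hf3]
    ring
  obtain ⟨M3, hM3⟩ : ∃ M3, ∀ x, |f3 x| ≤ M3 := ⟨_, b3⟩
  have cR1 : ∀ x, |g x + f3 x| ≤ D0 + M3 := fun x =>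
    (abs_add_le _ _).trans (add_le_add (e0 x) (hM3 x))
  obtain ⟨N2, hN2⟩ : ∃ N2, ∀ x, |x * g1 x + (g x + f3 x)| ≤ N2 := ⟨_, apriori_bdd cR1 k1 e1⟩
  have hM30 : 0 ≤ M3 := (abs_nonneg _).trans (hM3 0)
  have hN20 : 0 ≤ N2 := (abs_nonneg _).trans (hN2 0)
  refine ⟨M3 + N2 / 2, by positivity, fun lam hlam => ?_⟩
  have hl : (0 : ℝ) < lam := by
    have : (0 : NNReal) < lam := lt_of_lt_of_le one_pos hlam
    exact_mod_cast this
  set s := Real.sqrt lam with hsdef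
  have hs : 0 < s := Real.sqrt_pos.2 hl
  have hsr : s ^ 2 = lam := Real.sq_sqrt hl.le
  set h := 1 / s with hh
  have hh0 : 0 < h := by positivity
  have hsh : s * h = 1 := by rw [hh]; field_simp
  -- second order term
  have s2 : |(∫ k : ℕ, f2 (((k : ℝ) - lam) / s) ∂(poissonMeasure lam)) - m| ≤ N2 * h := by
    rw [po_main (c := m) b2 e0 hs hsr]
    refine abs_integral_po_le fun k => ?_
    set z := ((k : ℝ) - lam) / s
    have t := taylor_one k0 k1 hN2 z hh0.le
    calc _ = |-(s * (g (z + h) - g z - h * (z * g z + (f2 z - m))))| := by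
          congr 1
          linear_combination (-(z * g z + (f2 z - m))) * hsh
      _ = s * |g (z + h) - g z - h * (z * g z + (f2 z - m))| := by
          rw [abs_neg, abs_mul, abs_of_pos hs]
      _ ≤ s * (N2 * h ^ 2) := mul_le_mul_of_nonneg_left t hs.le
      _ = N2 * h * (s * h) := by ring
      _ = _ := by rw [hsh, mul_one]
  have s1 : |(∫ k : ℕ, F (((k : ℝ) - lam) / s) ∂(poissonMeasure lam)) - c
      + h / 2 * ∫ k : ℕ, f2 (((k : ℝ) - lam) / s) ∂(poissonMeasure lam)| ≤ M3 * h ^ 2 := by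
    rw [po_main (c := c) a0 b0 hs hsr, ← integral_const_mul, ← integral_add]
    rotate_left
    · refine integrable_po (B := 2 * (A0 + |c|) + s * (B0 + B0)) fun k => ?_
      refine (abs_sub _ _).trans (add_le_add (b1 _) ?_)
      rw [abs_mul, abs_of_pos hs]
      exact mul_le_mul_of_nonneg_left ((abs_sub _ _).trans (add_le_add (b0 _) (b0 _))) hs.le
    · exact (integrable_po (fun k => b2 _)).const_mul _
    refine abs_integral_po_le fun k => ?_
    set z := ((k : ℝ) - lam) / s
    have t := taylor_two h0 h1 h2 hM3 z hh0.le
    calc _ = |-(s * (f (z + h) - f z - h * f1 z - h ^ 2 / 2 * f2 z))| := by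
          congr 1
          simp only [hf1]
          linear_combination (-(z * f z + (F z - c)) - h / 2 * f2 z) * hsh
      _ = s * |f (z + h) - f z - h * f1 z - h ^ 2 / 2 * f2 z| := by
          rw [abs_neg, abs_mul, abs_of_pos hs]
      _ ≤ s * (M3 * h ^ 3) := mul_le_mul_of_nonneg_left t hs.le
      _ = M3 * h ^ 2 * (s * h) := by ring
      _ = _ := by rw [hsh, mul_one]
  set P := ∫ k : ℕ, F (((k : ℝ) - lam) / s) ∂(poissonMeasure lam)
  set Q := ∫ k : ℕ, f2 (((k : ℝ) - lam) / s) ∂(poissonMeasure lam)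
  set J := ∫ x, F x * (x ^ 3 - 3 * x) ∂(gaussianReal 0 1)
  have e6 : 1 / (6 * s) = h / 6 := by rw [hh]; field_simp
  have e7 : P - c - 1 / (6 * s) * J = (P - c + h / 2 * Q) - h / 2 * (Q - m) := by
    rw [e6, hm]; ring
  have e8 : h ^ 2 = 1 / lam := by rw [hh, ← hsr]; field_simp
  rw [e7]
  calc _ ≤ |P - c + h / 2 * Q| + |h / 2 * (Q - m)| := abs_sub _ _
    _ ≤ M3 * h ^ 2 + h / 2 * (N2 * h) := by
        refine add_le_add s1 ?_
        rw [abs_mul, abs_of_pos (by positivity : 0 < h / 2)]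
        exact mul_le_mul_of_nonneg_left s2 (by positivity)
    _ = (M3 + N2 / 2) * h ^ 2 := by ring
    _ = _ := by rw [e8]; ring

end Aux

/-- First-order Edgeworth expansion for the normal approximation of the normalized Poisson
distribution: for `F ∈ C³` with `F, F′, F″, F‴` bounded there is a constant `C ≥ 0`
(depending only on `F`) such that for all `λ ≥ 1`,
`|E[F(X̃_λ)] − ∫ F dγ − (1/(6√λ)) ∫ F·H₃ dγ| ≤ C/λ`, where `X̃_λ = (X_λ − λ)/√λ` for
`X_λ` Poisson of parameter `λ`, `γ = N(0,1)` and `H₃(x) = x³ − 3x`. -/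
theorem poisson_edgeworth_first_order
    (F : ℝ → ℝ) (hF : ContDiff ℝ 3 F)
    (hFb : ∀ i ≤ 3, ∃ C, ∀ x, |iteratedDeriv i F x| ≤ C) :
    ∃ C : ℝ, 0 ≤ C ∧ ∀ lam : NNReal, 1 ≤ lam →
      |(∫ k : ℕ, F (((k : ℝ) - lam) / Real.sqrt lam) ∂(poissonMeasure lam))
          - (∫ x, F x ∂(gaussianReal 0 1))
          - (1 / (6 * Real.sqrt lam)) *
              ∫ x, F x * (x ^ 3 - 3 * x) ∂(gaussianReal 0 1)|
        ≤ C / lam := by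
  obtain ⟨A0, a0⟩ := hFb 0 (by norm_num)
  obtain ⟨A1, a1⟩ := hFb 1 (by norm_num)
  obtain ⟨A2, a2⟩ := hFb 2 (by norm_num)
  have hd : ∀ (n : ℕ), n < 3 → ∀ x, HasDerivAt (iteratedDeriv n F) (iteratedDeriv (n + 1) F x) x := by
    intro n hn x
    rw [iteratedDeriv_succ]
    exact ((hF.differentiable_iteratedDeriv n (by exact_mod_cast hn)) x).hasDerivAt
  have d0 := hd 0 (by norm_num)
  have d1 := hd 1 (by norm_num)
  rw [iteratedDeriv_zero] at d0 a0
  exact edgeworth_aux d0 d1 a0 a1 a2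
end
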